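/- arXiv:2407.06944 — 3 statements merged into one kernel-verified Lean document; each statement's English description precedes it below -/
import Mathlib

section
/- Let p,q,r ∈ (1,∞) with 1/p + 1/q = 1 + 1/r. Let f, g : ℤ → ℂ be finitely supported with ‖f‖_p = ‖g‖_q = 1. If ‖f*g‖_r ≥ 1-δ for sufficiently small δ > 0, then there exists x₀ ∈ ℤ such that ‖f - f(x₀)·1_{{x₀}}‖_p^p ≤ C δ^{1/8}, with C depending only on p,q,r. -/
open Real

lemma aux_shift (G : ℤ → ℝ) (hG : Summable G) (s : ℤ) :
    Summable (fun a => G (s - a)) ∧ ∑' a, G (s - a) = ∑' a, G a :=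
  ⟨(Equiv.subLeft s).summable_iff.mpr hG, (Equiv.subLeft s).tsum_eq G⟩

/-- Window lemma. -/
lemma aux_window (F G : ℤ → ℝ) (hF : ∀ a, 0 ≤ F a)
    (sF : Summable F) (sG : Summable G)
    (ε : ℝ) (s s' : ℤ) (hss : s ≤ s')
    (h1 : ∑' a, |F a - G (s - a)| ≤ ε) (h2 : ∑' a, |F a - G (s' - a)| ≤ ε) (b : ℤ) :
    ∑ a ∈ Finset.Ico (s - b) (s' - b), F a ≤ 2 * ε := by
  set x := s - b with hx
  set y := s' - b with hy
  have sGs : ∀ s : ℤ, Summable (fun a => G (s - a)) := fun s => (aux_shift G sG s).1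
  have sA : ∀ s : ℤ, Summable (fun a => |F a - G (s - a)|) := fun s => (sF.sub (sGs s)).abs
  -- decomposition
  have e1 : ∑ a ∈ Finset.Ico x y, F a + ∑' a, (Set.Iio x).indicator F a
      = ∑' a, (Set.Iio y).indicator F a := by
    have : ∑ a ∈ Finset.Ico x y, F a = ∑' a, (Set.Ico x y).indicator F a := by
      rw [← Finset.coe_Ico, ← Finset.tsum_subtype', tsum_subtype]
    rw [this, ← Summable.tsum_add (sF.indicator _) (sF.indicator _)]
    congr 1
    funext a
    have : x ≤ y := by omega
    simp only [Set.indicator, Set.mem_Ico, Set.mem_Iio]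
    split_ifs <;> first | omega | (simp; done)
  have e2 : ∑' a, (Set.Iio y).indicator F a
      ≤ ∑' a, (Set.Iio y).indicator (fun a => G (s' - a)) a + ε := by
    have : ∑' a, (Set.Iio y).indicator F a
      ≤ ∑' a, ((Set.Iio y).indicator (fun a => G (s' - a)) a + |F a - G (s' - a)|) := by
      refine Summable.tsum_le_tsum ?_ (sF.indicator _) (((sGs s').indicator _).add (sA s'))
      intro a
      simp only [Set.indicator]
      split_ifs
      · linarith [le_abs_self (F a - G (s' - a))]
      · linarith [abs_nonneg (F a - G (s' - a))]
    rw [Summable.tsum_add ((sGs s').indicator _) (sA s')] at this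
    linarith
  have e3 : ∑' a, (Set.Iio x).indicator (fun a => G (s - a)) a
      ≤ ∑' a, (Set.Iio x).indicator F a + ε := by
    have : ∑' a, (Set.Iio x).indicator (fun a => G (s - a)) a
      ≤ ∑' a, ((Set.Iio x).indicator F a + |F a - G (s - a)|) := by
      refine Summable.tsum_le_tsum ?_ ((sGs s).indicator _) ((sF.indicator _).add (sA s))
      intro a
      simp only [Set.indicator]
      split_ifs
      · linarith [neg_abs_le (F a - G (s - a))]
      · linarith [abs_nonneg (F a - G (s - a))]
    rw [Summable.tsum_add (sF.indicator _) (sA s)] at this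
    linarith
  have e4 : ∑' a, (Set.Iio y).indicator (fun a => G (s' - a)) a
      = ∑' a, (Set.Iio x).indicator (fun a => G (s - a)) a := by
    rw [← (Equiv.addRight (s' - s)).tsum_eq]
    congr 1
    funext a
    simp only [Set.indicator, Set.mem_Iio, Equiv.coe_addRight]
    have : s' - (a + (s' - s)) = s - a := by ring
    rw [this]
    congr 1
    apply propext
    omega
  linarith

lemma aux_A (F G : ℤ → ℝ) (hF : ∀ a, 0 ≤ F a) (hG : ∀ a, 0 ≤ G a)
    (sF : HasSum F 1) (sG : HasSum G 1) (S : Finset ℤ) (ε : ℝ) (hε : 0 ≤ ε) (x₀ : ℤ)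
    (hx : ∀ a, F a ≤ F x₀) (hS : ∀ s ∈ S, ∑' a, |F a - G (s - a)| ≤ ε) :
    ∑ s ∈ S, ∑' a, F a * G (s - a) ≤ 2 * ε + F x₀ := by
  rcases S.eq_empty_or_nonempty with rfl | hne
  · simp; linarith [hF x₀]
  have key : ∀ b, ∑ s ∈ S, F (s - b) ≤ 2 * ε + F x₀ := by
    intro b
    have hle : S.min' hne ≤ S.max' hne := S.min'_le_max' hne
    have w := aux_window F G hF sF.summable sG.summable ε (S.min' hne) (S.max' hne) hle
      (hS _ (S.min'_mem hne)) (hS _ (S.max'_mem hne)) b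
    have : ∑ s ∈ S, F (s - b) ≤ ∑ a ∈ Finset.Icc (S.min' hne - b) (S.max' hne - b), F a := by
      rw [← Finset.sum_image (f := F) (g := fun s => s - b) (s := S) (by intro a _ c _ h; simpa using h)]
      apply Finset.sum_le_sum_of_subset_of_nonneg
      · intro a ha
        obtain ⟨s, hs, rfl⟩ := Finset.mem_image.1 ha
        have h1 := S.min'_le s hs
        have h2 := S.le_max' s hs
        rw [Finset.mem_Icc]; constructor <;> omega
      · intros; exact hF _
    rw [← Finset.Ico_insert_right (by omega), Finset.sum_insert (by simp)] at this
    linarith [hx (S.max' hne - b)]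
  have sw : ∀ s : ℤ, Summable (fun b => F (s - b) * G b) := by
    intro s
    refine Summable.of_nonneg_of_le (fun b => mul_nonneg (hF _) (hG _))
      (fun b => mul_le_mul_of_nonneg_right (hx _) (hG _)) (sG.summable.mul_left (F x₀))
  have e : ∀ s ∈ S, ∑' a, F a * G (s - a) = ∑' b, F (s - b) * G b := by
    intro s _
    rw [← (Equiv.subLeft s).tsum_eq]
    simp
  rw [Finset.sum_congr rfl e, ← Summable.tsum_finsetSum (fun s _ => sw s)]
  calc ∑' b, ∑ s ∈ S, F (s - b) * G b ≤ ∑' b, (2 * ε + F x₀) * G b := by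
        refine Summable.tsum_le_tsum ?_ (summable_sum (fun s _ => sw s)) (sG.summable.mul_left _)
        intro b
        rw [← Finset.sum_mul]
        exact mul_le_mul_of_nonneg_right (key b) (hG b)
    _ = 2 * ε + F x₀ := by rw [tsum_mul_left, sG.tsum_eq, mul_one]

lemma aux_amgm (α β γ κ u v z : ℝ) (hα : 0 < α) (hκ : 0 < κ) (hβ : κ ≤ β) (hγ : κ ≤ γ)
    (h1 : α + β + γ = 1) (hu : 0 ≤ u) (hv : 0 ≤ v) (hz : 0 ≤ z) :
    κ * (√v - √z) ^ 2 ≤ α * u + β * v + γ * z - u ^ α * v ^ β * z ^ γ := by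
  have h := Real.geom_mean_le_arith_mean4_weighted (w₁ := α) (w₂ := β - κ) (w₃ := γ - κ)
    (w₄ := 2 * κ) (p₁ := u) (p₂ := v) (p₃ := z) (p₄ := √v * √z) hα.le (by linarith)
    (by linarith) (by linarith) hu hv hz (by positivity) (by linarith)
  have e : (√v * √z) ^ (2 * κ) = v ^ κ * z ^ κ := by
    rw [Real.rpow_mul (by positivity), ← Real.mul_rpow hv hz]
    congr 1
    rw [Real.rpow_two, mul_pow, Real.sq_sqrt hv, Real.sq_sqrt hz]
  have ev : v ^ β = v ^ (β - κ) * v ^ κ := by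
    rw [← Real.rpow_add_of_nonneg hv (by linarith) hκ.le]; congr 1; ring
  have ez : z ^ γ = z ^ (γ - κ) * z ^ κ := by
    rw [← Real.rpow_add_of_nonneg hz (by linarith) hκ.le]; congr 1; ring
  rw [e] at h
  rw [ev, ez]
  have h2 : (√v - √z) ^ 2 = v + z - 2 * (√v * √z) := by
    have := Real.sq_sqrt hv
    have := Real.sq_sqrt hz
    nlinarith
  rw [h2]
  nlinarith

lemma aux_B (α β γ κ τ t : ℝ) (u v z : ℤ → ℝ) (hα : 0 < α) (hκ : 0 < κ) (hβ : κ ≤ β)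
    (hγ : κ ≤ γ) (h1 : α + β + γ = 1) (hu : ∀ a, 0 ≤ u a) (hv : ∀ a, 0 ≤ v a)
    (hz : ∀ a, 0 ≤ z a) (su : HasSum u 1) (sv : HasSum v 1) (sz : HasSum z 1) (ht : 0 < t)
    (hτ : 1 - τ ≤ ∑' a, u a ^ α * v a ^ β * z a ^ γ) :
    (∑' a, u a ^ α * v a ^ β * z a ^ γ ≤ 1) ∧
    ∑' a, |v a - z a| ≤ τ / (2 * κ * t) + 2 * t := by
  have hp := fun a => aux_amgm α β γ κ (u a) (v a) (z a) hα hκ hβ hγ h1 (hu a) (hv a) (hz a)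
  have sL : HasSum (fun a => α * u a + β * v a + γ * z a) 1 := by
    have := ((su.mul_left α).add (sv.mul_left β)).add (sz.mul_left γ)
    simpa [h1] using this
  have sP : Summable (fun a => u a ^ α * v a ^ β * z a ^ γ) := by
    refine Summable.of_nonneg_of_le (fun a => ?_) (fun a => ?_) sL.summable
    · have := hu a; have := hv a; have := hz a; positivity
    · have := hp a
      have : 0 ≤ κ * (√(v a) - √(z a)) ^ 2 := by positivity
      linarith
  refine ⟨?_, ?_⟩
  · rw [← sL.tsum_eq]
    refine Summable.tsum_le_tsum (fun a => ?_) sP sL.summable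
    have := hp a
    have : 0 ≤ κ * (√(v a) - √(z a)) ^ 2 := by positivity
    linarith
  have sD := (((sL.sub sP.hasSum).mul_left (1 / (2 * κ * t))).add ((sv.add sz).mul_left t))
  have : ∑' a, |v a - z a| ≤ 1 / (2 * κ * t) * (1 - ∑' a, u a ^ α * v a ^ β * z a ^ γ)
      + t * (1 + 1) := by
    refine (Summable.tsum_le_tsum (fun a => ?_) (sv.summable.sub sz.summable).abs
      sD.summable).trans_eq sD.tsum_eq
    have h := hp a
    have e1 : v a = √(v a) ^ 2 := (Real.sq_sqrt (hv a)).symm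
    have e2 : z a = √(z a) ^ 2 := (Real.sq_sqrt (hz a)).symm
    have h3 : (1 / (2 * κ * t)) * (κ * (√(v a) - √(z a)) ^ 2) ≤
      (1 / (2 * κ * t)) * (α * u a + β * v a + γ * z a - u a ^ α * v a ^ β * z a ^ γ) :=
      mul_le_mul_of_nonneg_left h (by positivity)
    have h4 : (1 / (2 * κ * t)) * (κ * (√(v a) - √(z a)) ^ 2)
        = (√(v a) - √(z a)) ^ 2 / (2 * t) := by field_simp
    rw [h4] at h3
    refine le_trans ?_ (add_le_add_left h3 _)
    have h5 : |v a - z a| = |√(v a) - √(z a)| * (√(v a) + √(z a)) := by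
      rw [← abs_of_nonneg (show 0 ≤ √(v a) + √(z a) by positivity), ← abs_mul]
      congr 1
      nlinarith
    have h6 : (√(v a) + √(z a)) ^ 2 ≤ 2 * (v a + z a) := by
      nlinarith [sq_nonneg (√(v a) - √(z a))]
    rw [h5, ← sq_abs (√(v a) - √(z a))]
    set A := |√(v a) - √(z a)|
    set B := √(v a) + √(z a)
    have h7 : A * B ≤ A ^ 2 / (2 * t) + t / 2 * B ^ 2 := by
      have : A ^ 2 / (2 * t) + t / 2 * B ^ 2 - A * B = (A - t * B) ^ 2 / (2 * t) := by
        field_simp; ring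
      have : 0 ≤ (A - t * B) ^ 2 / (2 * t) := by positivity
      linarith
    have h8 : t / 2 * B ^ 2 ≤ t / 2 * (2 * (v a + z a)) :=
      mul_le_mul_of_nonneg_left h6 (by positivity)
    linarith
  refine this.trans ?_
  have : 1 / (2 * κ * t) * (1 - ∑' a, u a ^ α * v a ^ β * z a ^ γ) ≤ 1 / (2 * κ * t) * τ :=
    mul_le_mul_of_nonneg_left (by linarith) (by positivity)
  have e : τ / (2 * κ * t) = 1 / (2 * κ * t) * τ := by ring
  rw [e]; linarith


lemma aux_main (p q r α β γ : ℝ) (hp : 1 < p) (hq : 1 < q) (hr : 1 < r)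
    (hα : α = 1 / r) (hβ : β = 1 - 1 / q) (hγ : γ = 1 - 1 / p)
    (hpqr : 1 / p + 1 / q = 1 + 1 / r) (w x y : ℝ) (hw : 0 < w) (hx : 0 ≤ x) (hy : 0 ≤ y) :
    x * y = w ^ (1 / r) * ((x ^ p * y ^ q / w) ^ α * (x ^ p) ^ β * (y ^ q) ^ γ) := by
  have hp0 : 0 < p := by linarith
  have hq0 : 0 < q := by linarith
  have hr0 : 0 < r := by linarith
  have hxp : 0 ≤ x ^ p := by positivity
  have hyq : 0 ≤ y ^ q := by positivity
  have hα0 : 0 < α := by rw [hα]; positivity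
  have hβ0 : 0 < β := by
    rw [hβ]; have : 1 / q < 1 := by rw [div_lt_one hq0]; exact hq
    linarith
  have hγ0 : 0 < γ := by
    rw [hγ]; have : 1 / p < 1 := by rw [div_lt_one hp0]; exact hp
    linarith
  have hwα : 0 < w ^ α := by positivity
  rw [← hα, Real.div_rpow (by positivity) hw.le, Real.mul_rpow hxp hyq]
  have e1 : (x ^ p) ^ α * (x ^ p) ^ β = x := by
    rw [← Real.rpow_add_of_nonneg hxp hα0.le hβ0.le, ← Real.rpow_mul hx]
    have : p * (α + β) = 1 := by
      have : α + β = 1 / p := by linarith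
      rw [this]; field_simp
    rw [this, Real.rpow_one]
  have e2 : (y ^ q) ^ α * (y ^ q) ^ γ = y := by
    rw [← Real.rpow_add_of_nonneg hyq hα0.le hγ0.le, ← Real.rpow_mul hy]
    have : q * (α + γ) = 1 := by
      have : α + γ = 1 / q := by linarith
      rw [this]; field_simp
    rw [this, Real.rpow_one]
  conv_lhs => rw [← e1, ← e2]
  field_simp

/-- Stability (approximate inverse) theorem for Young's convolution inequality on ℤ. -/
theorem stmt_11 (p q r : ℝ) (hp : 1 < p) (hq : 1 < q) (hr : 1 < r)
    (hpqr : 1 / p + 1 / q = 1 + 1 / r) :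
    ∃ C > (0:ℝ), ∃ δ₀ > (0:ℝ), ∀ δ : ℝ, 0 < δ → δ ≤ δ₀ →
      ∀ f g : ℤ → ℂ, (Function.support f).Finite → (Function.support g).Finite →
        (∑' a : ℤ, ‖f a‖ ^ p) ^ (1 / p) = 1 →
        (∑' a : ℤ, ‖g a‖ ^ q) ^ (1 / q) = 1 →
        1 - δ ≤ (∑' s : ℤ, ‖∑' a : ℤ, f a * g (s - a)‖ ^ r) ^ (1 / r) →
        ∃ x₀ : ℤ,
          (∑' a : ℤ, ‖f a - (if a = x₀ then f x₀ else 0)‖ ^ p) ≤ C * δ ^ ((1:ℝ)/8) := by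
  have hp0 : 0 < p := by linarith
  have hq0 : 0 < q := by linarith
  have hr0 : 0 < r := by linarith
  obtain ⟨α, hα⟩ : ∃ α, α = 1 / r := ⟨_, rfl⟩
  obtain ⟨β, hβ⟩ : ∃ β, β = 1 - 1 / q := ⟨_, rfl⟩
  obtain ⟨γ, hγ⟩ : ∃ γ, γ = 1 - 1 / p := ⟨_, rfl⟩
  have hα0 : 0 < α := by rw [hα]; positivity
  have hβ0 : 0 < β := by
    rw [hβ]; have : 1 / q < 1 := by rw [div_lt_one hq0]; exact hq
    linarith
  have hγ0 : 0 < γ := by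
    rw [hγ]; have : 1 / p < 1 := by rw [div_lt_one hp0]; exact hp
    linarith
  have hsum : α + β + γ = 1 := by linarith
  obtain ⟨κ, hκ⟩ : ∃ κ, κ = min β γ := ⟨_, rfl⟩
  have hκ0 : 0 < κ := by rw [hκ]; exact lt_min hβ0 hγ0
  have hκβ : κ ≤ β := by rw [hκ]; exact min_le_left _ _
  have hκγ : κ ≤ γ := by rw [hκ]; exact min_le_right _ _
  refine ⟨2 * r + 1 / κ + 4, by positivity, 1 / 2, by norm_num, ?_⟩
  intro δ hδ hδ2 f g hf hg hfp hgq hfg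
  obtain ⟨t, ht⟩ : ∃ t, t = δ ^ ((1:ℝ)/8) := ⟨_, rfl⟩
  have ht0 : 0 < t := by rw [ht]; positivity
  have ht1 : t < 1 := by rw [ht]; exact Real.rpow_lt_one hδ.le (by linarith) (by norm_num)
  have ht8 : δ = t ^ 8 := by
    rw [ht, ← Real.rpow_natCast, ← Real.rpow_mul hδ.le]; norm_num
  rw [← ht]
  obtain ⟨F, hFd⟩ : ∃ F : ℤ → ℝ, F = fun a => ‖f a‖ ^ p := ⟨_, rfl⟩
  obtain ⟨G, hGd⟩ : ∃ G : ℤ → ℝ, G = fun a => ‖g a‖ ^ q := ⟨_, rfl⟩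
  have hF : ∀ a, 0 ≤ F a := fun a => by rw [hFd]; positivity
  have hG : ∀ a, 0 ≤ G a := fun a => by rw [hGd]; positivity
  have sF : HasSum F 1 := by
    have h1 : ∑' a, ‖f a‖ ^ p = 1 :=
      (Real.rpow_left_inj (tsum_nonneg fun a => by positivity) zero_le_one
        (one_div_pos.2 hp0).ne').1 (by rw [hfp, Real.one_rpow])
    have h2 : Summable F := by
      refine summable_of_hasFiniteSupport (hf.subset ?_)
      intro a ha hfa
      apply ha
      simp [hFd, hfa, hp0.ne']
    rw [← h1]; rw [hFd] at h2 ⊢; exact h2.hasSum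
  have sG : HasSum G 1 := by
    have h1 : ∑' a, ‖g a‖ ^ q = 1 :=
      (Real.rpow_left_inj (tsum_nonneg fun a => by positivity) zero_le_one
        (one_div_pos.2 hq0).ne').1 (by rw [hgq, Real.one_rpow])
    have h2 : Summable G := by
      refine summable_of_hasFiniteSupport (hg.subset ?_)
      intro a ha hfa
      apply ha
      simp [hGd, hfa, hq0.ne']
    rw [← h1]; rw [hGd] at h2 ⊢; exact h2.hasSum
  have hF1 : ∀ a, F a ≤ 1 := fun a => by
    rw [← sF.tsum_eq]; exact sF.summable.le_tsum a (fun b _ => hF b)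
  have sGs : ∀ s : ℤ, HasSum (fun a => G (s - a)) 1 := fun s => by
    have := aux_shift G sG.summable s
    rw [← sG.tsum_eq, ← this.2]; exact this.1.hasSum
  -- the maximum
  obtain ⟨x₀, hx₀⟩ : ∃ x₀, ∀ a, F a ≤ F x₀ := by
    have hne : hf.toFinset.Nonempty := by
      by_contra h
      rw [Finset.not_nonempty_iff_eq_empty] at h
      have : ∀ a, F a = 0 := by
        intro a
        have : a ∉ hf.toFinset := by rw [h]; simp
        have : f a = 0 := by simpa using this
        simp [hFd, this, hp0.ne']
      have h2 := sF.tsum_eq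
      simp [this] at h2
    obtain ⟨x₀, -, h⟩ := Finset.exists_max_image hf.toFinset F hne
    refine ⟨x₀, fun a => ?_⟩
    by_cases ha : f a = 0
    · have : F a = 0 := by simp [hFd, ha, hp0.ne']
      rw [this]; exact hF _
    · exact h a (by simpa using ha)
  refine ⟨x₀, ?_⟩
  -- goal in terms of F
  have hgoal : ∑' a : ℤ, ‖f a - (if a = x₀ then f x₀ else 0)‖ ^ p = 1 - F x₀ := by
    have h1 : HasSum (fun a => F a - (if a = x₀ then F x₀ else 0)) (1 - F x₀) :=
      sF.sub (hasSum_ite_eq x₀ (F x₀))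
    rw [← h1.tsum_eq]
    congr 1
    funext a
    by_cases ha : a = x₀
    · subst ha; simp [hp0.ne']
    · simp [ha, hFd]
  rw [hgoal]
  -- convolution
  obtain ⟨w, hw⟩ : ∃ w : ℤ → ℝ, w = fun s => ∑' a, F a * G (s - a) := ⟨_, rfl⟩
  obtain ⟨ρ, hρ⟩ : ∃ ρ : ℤ → ℝ, ρ = fun s =>
    ∑' a, (F a * G (s - a) / w s) ^ α * F a ^ β * G (s - a) ^ γ := ⟨_, rfl⟩
  have sw : ∀ s, Summable (fun a => F a * G (s - a)) := fun s => by
    refine Summable.of_nonneg_of_le (fun a => mul_nonneg (hF _) (hG _)) (fun a => ?_)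
      (sGs s).summable
    nlinarith [hF1 a, hG (s - a)]
  have hw0 : ∀ s, 0 ≤ w s := fun s => by
    rw [hw]; exact tsum_nonneg fun a => mul_nonneg (hF _) (hG _)
  have su : ∀ s, 0 < w s → HasSum (fun a => F a * G (s - a) / w s) 1 := fun s hs => by
    have := (sw s).hasSum.div_const (w s)
    have e : (∑' a, F a * G (s - a)) / w s = 1 := by
      have : ∑' a, F a * G (s - a) = w s := by rw [hw]
      rw [this]; field_simp
    rwa [e] at this
  have hρ0 : ∀ s, 0 ≤ ρ s := fun s => by
    rw [hρ]
    refine tsum_nonneg fun a => ?_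
    have := hF a; have := hG (s - a); have := hw0 s
    positivity
  have hρz : ∀ s, w s = 0 → ρ s = 0 := fun s hs => by
    simp only [hρ, hs, div_zero, Real.zero_rpow hα0.ne', zero_mul, tsum_zero]
  have hB : ∀ s τ t', 0 < w s → 0 < t' → 1 - τ ≤ ρ s →
      ρ s ≤ 1 ∧ ∑' a, |F a - G (s - a)| ≤ τ / (2 * κ * t') + 2 * t' := by
    intro s τ t' hs ht' h
    have := aux_B α β γ κ τ t' (fun a => F a * G (s - a) / w s) F (fun a => G (s - a))
      hα0 hκ0 hκβ hκγ hsum (fun a => div_nonneg (mul_nonneg (hF _) (hG _)) (hw0 s)) hF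
      (fun a => hG _) (su s hs) sF (sGs s) ht' (by rw [hρ] at h; exact h)
    rw [hρ]; exact this
  have hρ1 : ∀ s, ρ s ≤ 1 := fun s => by
    rcases (hw0 s).eq_or_lt with h | h
    · rw [hρz s h.symm]; norm_num
    · exact (hB s 1 1 h one_pos (by linarith [hρ0 s])).1
  have hconv : ∀ s, ‖∑' a, f a * g (s - a)‖ ^ r ≤ w s * ρ s := by
    intro s
    rcases (hw0 s).eq_or_lt with h | h
    · have hz : ∀ a, f a * g (s - a) = 0 := by
        have h0 : HasSum (fun a => F a * G (s - a)) 0 := by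
          have := (sw s).hasSum
          have e : ∑' a, F a * G (s - a) = w s := by rw [hw]
          rwa [e, ← h] at this
        rw [hasSum_zero_iff_of_nonneg (fun a => mul_nonneg (hF _) (hG _))] at h0
        intro a
        have := congrFun h0 a
        simp only [Pi.zero_apply, mul_eq_zero, hFd, hGd] at this
        rcases this with h | h
        · rw [Real.rpow_eq_zero (norm_nonneg _) hp0.ne'] at h
          simp [norm_eq_zero.1 h]
        · rw [Real.rpow_eq_zero (norm_nonneg _) hq0.ne'] at h
          simp [norm_eq_zero.1 h]
      simp only [hz, tsum_zero, norm_zero, Real.zero_rpow hr0.ne', ← h, zero_mul, le_refl]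
    · have e : ∀ a, ‖f a * g (s - a)‖ = w s ^ (1 / r) *
          ((F a * G (s - a) / w s) ^ α * F a ^ β * G (s - a) ^ γ) := by
        intro a
        rw [norm_mul, hFd, hGd]
        exact aux_main p q r α β γ hp hq hr hα hβ hγ hpqr (w s) _ _ h (norm_nonneg _)
          (norm_nonneg _)
      have s1 : Summable (fun a => ‖f a * g (s - a)‖) := by
        refine summable_of_hasFiniteSupport (hf.subset ?_)
        intro a ha hfa
        apply ha
        simp [hfa]
      have h1 : ‖∑' a, f a * g (s - a)‖ ≤ w s ^ (1 / r) * ρ s := by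
        refine (norm_tsum_le_tsum_norm s1).trans_eq ?_
        simp only [e, hρ]
        rw [tsum_mul_left]
      calc ‖∑' a, f a * g (s - a)‖ ^ r ≤ (w s ^ (1 / r) * ρ s) ^ r :=
            Real.rpow_le_rpow (norm_nonneg _) h1 hr0.le
        _ = w s * ρ s ^ r := by
            rw [Real.mul_rpow (by positivity) (hρ0 s), ← Real.rpow_mul h.le]
            rw [one_div_mul_cancel hr0.ne', Real.rpow_one]
        _ ≤ w s * ρ s := by
            refine mul_le_mul_of_nonneg_left ?_ h.le
            exact Real.rpow_le_self_of_le_one (hρ0 s) (hρ1 s) hr.le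
  -- finite set
  obtain ⟨T, hT⟩ : ∃ T : Finset ℤ, ∀ s, s ∉ T → ∑' a, f a * g (s - a) = 0 := by
    refine ⟨Finset.image (fun x : ℤ × ℤ => x.1 + x.2) (hf.toFinset ×ˢ hg.toFinset), ?_⟩
    intro s hs
    have : ∀ a, f a * g (s - a) = 0 := by
      intro a
      by_contra h
      apply hs
      rw [Finset.mem_image]
      refine ⟨(a, s - a), ?_, by simp⟩
      simpa [not_or] using h
    simp [this]
  have hT1 : 1 - r * δ ≤ ∑ s ∈ T, w s * ρ s := by
    have h1 : ∑' s : ℤ, ‖∑' a : ℤ, f a * g (s - a)‖ ^ r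
        = ∑ s ∈ T, ‖∑' a : ℤ, f a * g (s - a)‖ ^ r := by
      refine tsum_eq_sum fun s hs => ?_
      rw [hT s hs, norm_zero, Real.zero_rpow hr0.ne']
    rw [h1] at hfg
    have hnn : 0 ≤ ∑ s ∈ T, ‖∑' a : ℤ, f a * g (s - a)‖ ^ r :=
      Finset.sum_nonneg fun s _ => by positivity
    have h2 : (1 - δ) ^ r ≤ ∑ s ∈ T, ‖∑' a : ℤ, f a * g (s - a)‖ ^ r := by
      have := Real.rpow_le_rpow (by linarith) hfg hr0.le
      rwa [← Real.rpow_mul hnn, one_div_mul_cancel hr0.ne', Real.rpow_one] at this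
    have h3 : 1 + r * (-δ) ≤ (1 + -δ) ^ r :=
      one_add_mul_self_le_rpow_one_add (by linarith) hr.le
    have h4 := Finset.sum_le_sum fun s (_ : s ∈ T) => hconv s
    have e : (1 - δ) = 1 + -δ := by ring
    rw [e] at h2
    linarith
  have hT2 : ∑ s ∈ T, w s ≤ 1 := by
    simp only [hw]
    rw [← Summable.tsum_finsetSum (fun s _ => sw s), ← sF.tsum_eq]
    refine Summable.tsum_le_tsum (fun a => ?_) (summable_sum (fun s _ => sw s)) sF.summable
    rw [← Finset.mul_sum]
    have : ∑ s ∈ T, G (s - a) ≤ 1 := by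
      have h := (Equiv.subRight a).hasSum_iff.mpr sG
      exact sum_le_hasSum T (fun s _ => hG _) h
    nlinarith [hF a]
  -- good set
  obtain ⟨S, hS⟩ : ∃ S, S = T.filter (fun s => 1 - t ^ 2 ≤ ρ s) := ⟨_, rfl⟩
  have hSw : 1 - r * δ - r * t ^ 6 ≤ ∑ s ∈ S, w s := by
    have h1 : ∑ s ∈ T, w s * ρ s ≤ ∑ s ∈ T, w s :=
      Finset.sum_le_sum fun s _ => by nlinarith [hw0 s, hρ1 s]
    have h2 := Finset.sum_filter_add_sum_filter_not T (fun s => 1 - t ^ 2 ≤ ρ s) w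
    rw [← hS] at h2
    have h3 : t ^ 2 * ∑ s ∈ T.filter (fun s => ¬ 1 - t ^ 2 ≤ ρ s), w s
        ≤ ∑ s ∈ T, w s * (1 - ρ s) := by
      rw [Finset.mul_sum]
      refine (Finset.sum_le_sum fun s hs => ?_).trans
        (Finset.sum_le_sum_of_subset_of_nonneg (Finset.filter_subset _ T) ?_)
      · have := (Finset.mem_filter.1 hs).2
        push Not at this
        nlinarith [hw0 s]
      · intro s _ _
        exact mul_nonneg (hw0 s) (by linarith [hρ1 s])
    have h4 : ∑ s ∈ T, w s * (1 - ρ s) ≤ r * δ := by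
      simp only [mul_sub, mul_one, Finset.sum_sub_distrib]
      linarith
    have h5 : ∑ s ∈ T.filter (fun s => ¬ 1 - t ^ 2 ≤ ρ s), w s ≤ r * t ^ 6 := by
      refine le_of_mul_le_mul_left (?_ : t ^ 2 * _ ≤ t ^ 2 * _) (by positivity)
      calc _ ≤ _ := h3
        _ ≤ _ := h4
        _ = _ := by rw [ht8]; ring
    linarith
  have hA := aux_A F G hF hG sF sG S (t ^ 2 / (2 * κ * t) + 2 * t) (by positivity) x₀ hx₀ (by
    intro s hs
    rw [hS, Finset.mem_filter] at hs
    have hpos : 0 < w s := by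
      refine (hw0 s).lt_of_ne' fun h => ?_
      have := hρz s h
      nlinarith [hs.2]
    exact (hB s (t ^ 2) t hpos ht0 hs.2).2)
  have hA' : ∑ s ∈ S, w s ≤ 2 * (t ^ 2 / (2 * κ * t) + 2 * t) + F x₀ := by
    rw [hw]; exact hA
  have e : 2 * (t ^ 2 / (2 * κ * t) + 2 * t) = (1 / κ + 4) * t := by
    field_simp; ring
  have h6 : t ^ 6 ≤ t := pow_le_of_le_one ht0.le ht1.le (by norm_num)
  have h8 : t ^ 8 ≤ t := pow_le_of_le_one ht0.le ht1.le (by norm_num)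
  rw [e] at hA'
  rw [ht8] at hSw
  have h9 := mul_le_mul_of_nonneg_left h6 hr0.le
  have h10 := mul_le_mul_of_nonneg_left h8 hr0.le
  have e2 : (2 * r + 1 / κ + 4) * t = r * t + r * t + (1 / κ + 4) * t := by ring
  rw [e2]
  linarith
end

section
/- Let n ≥ 2 and let f : ℤ → ℝ be supported on a set of size n. There is an absolute constant c > 0 such that if q = 4/(3 - log_n(1+c)), then ‖f̂‖_{L⁴(ℝ/ℤ)} ≤ ‖f‖_{ℓ^q}, i.e. (∫₀¹|f̂(θ)|⁴dθ)^{1/4} ≤ (Σ_a |f(a)|^q)^{1/q}. -/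
open Real Complex

/-- Additive energy of `f` restricted to `A`. -/
noncomputable def enE (A : Finset ℤ) (f : ℤ → ℝ) : ℝ :=
  ∑ a ∈ A, ∑ b ∈ A, ∑ c ∈ A, ∑ d ∈ A, if a + b = c + d then f a * f b * (f c * f d) else 0

noncomputable def corR (A : Finset ℤ) (v : ℤ → ℝ) (b c : ℤ) : ℝ :=
  ∑ a ∈ A, ∑ d ∈ A, if a + b = c + d then v a * v d else 0

noncomputable def kk (x y : ℤ) : ℝ := if y < x then 1 else if y = x then 1/2 else 0

noncomputable def midH (A : Finset ℤ) (u : ℤ → ℝ) (x : ℤ) : ℝ := ∑ y ∈ A, u y * kk x y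

lemma kk_nonneg (x y : ℤ) : 0 ≤ kk x y := by unfold kk; split_ifs <;> norm_num
lemma kk_le (x y : ℤ) : kk x y ≤ 1 := by unfold kk; split_ifs <;> norm_num

lemma mid_ident (u : ℤ → ℝ) (A : Finset ℤ) :
    (∑ x ∈ A, u x * midH A u x = (∑ x ∈ A, u x)^2 / 2) ∧
    (∑ x ∈ A, u x * midH A u x ^ 2 = (∑ x ∈ A, u x)^3 / 3 - (∑ x ∈ A, u x ^ 3) / 12) := by
  induction A using Finset.induction_on_max with
  | empty => simp
  | insert m A hm ih =>
    have hmA : m ∉ A := fun h => lt_irrefl _ (hm m h)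
    have h1 : ∀ x ∈ A, midH (insert m A) u x = midH A u x := by
      intro x hx
      have h2 := hm x hx
      unfold midH
      rw [Finset.sum_insert hmA]
      have : kk x m = 0 := by
        unfold kk
        rw [if_neg (by omega), if_neg (by omega)]
      rw [this]; ring
    have h2 : midH (insert m A) u m = u m / 2 + ∑ x ∈ A, u x := by
      unfold midH
      rw [Finset.sum_insert hmA]
      congr 1
      · simp [kk]; ring
      · refine Finset.sum_congr rfl fun x hx => ?_
        simp [kk, hm x hx]
    obtain ⟨i1, i2⟩ := ih
    have h3 : ∀ x ∈ A, u x * midH (insert m A) u x = u x * midH A u x :=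
      fun x hx => by rw [h1 x hx]
    have h4 : ∀ x ∈ A, u x * midH (insert m A) u x ^ 2 = u x * midH A u x ^ 2 :=
      fun x hx => by rw [h1 x hx]
    constructor
    · rw [Finset.sum_insert hmA, Finset.sum_insert hmA, h2,
        Finset.sum_congr rfl h3, i1]
      ring
    · rw [Finset.sum_insert hmA, Finset.sum_insert hmA, Finset.sum_insert hmA, h2,
        Finset.sum_congr rfl h4, i2]
      ring

lemma var_ident (u : ℤ → ℝ) (A : Finset ℤ) (hu : ∑ x ∈ A, u x = 1) :
    ∑ b ∈ A, ∑ c ∈ A, u b * u c * (midH A u b - midH A u c)^2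
      = (1 - ∑ x ∈ A, u x ^ 3) / 6 := by
  obtain ⟨i1, i2⟩ := mid_ident u A
  have : ∀ b ∈ A, ∑ c ∈ A, u b * u c * (midH A u b - midH A u c)^2
     = u b * midH A u b ^ 2 * (∑ c ∈ A, u c) - 2 * (u b * midH A u b) * (∑ c ∈ A, u c * midH A u c)
       + u b * ∑ c ∈ A, u c * midH A u c ^ 2 := by
    intro b _
    rw [Finset.mul_sum, Finset.mul_sum, Finset.mul_sum, ← Finset.sum_sub_distrib,
      ← Finset.sum_add_distrib]
    exact Finset.sum_congr rfl fun c _ => by ring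
  rw [Finset.sum_congr rfl this, Finset.sum_add_distrib, Finset.sum_sub_distrib,
    ← Finset.sum_mul, ← Finset.sum_mul, ← Finset.sum_mul, ← Finset.mul_sum, i1, i2, hu]
  ring

lemma sum_shift (A S : Finset ℤ) (t : ℤ) (F : ℤ → ℝ) (hF : ∀ x, x ∉ A → F x = 0)
    (hS : ∀ x ∈ A, x - t ∈ S) : ∑ a ∈ S, F (a + t) = ∑ x ∈ A, F x := by
  have h : ∑ x ∈ A, F x = ∑ y ∈ A.image (fun x => x - t), F (y + t) := by
    rw [Finset.sum_image]
    · exact Finset.sum_congr rfl fun x _ => by simp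
    · intro x _ y _ h
      simpa using h
  rw [h]
  symm
  refine Finset.sum_subset ?_ ?_
  · intro y hy
    obtain ⟨x, hx, rfl⟩ := Finset.mem_image.1 hy
    exact hS x hx
  · intro x _ hx
    apply hF
    intro h
    exact hx (Finset.mem_image.2 ⟨x + t, h, by ring⟩)

lemma cor_bound (A : Finset ℤ) (v : ℤ → ℝ) (hv : ∀ x, x ∉ A → v x = 0) (b c : ℤ) :
    (midH A (fun x => v x ^ 2) b - midH A (fun x => v x ^ 2) c)^2
      ≤ 4 * ((∑ x ∈ A, v x ^ 2)^2 - corR A v b c ^ 2) := by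
  set U := ∑ x ∈ A, v x ^ 2 with hU
  set R := corR A v b c with hR
  set t := b - c with ht
  set S := A ∪ A.image (fun x => x - t) with hS
  have hAS : A ⊆ S := Finset.subset_union_left
  have hSt : ∀ x ∈ A, x - t ∈ S := fun x hx =>
    Finset.mem_union_right _ (Finset.mem_image_of_mem _ hx)
  have e1 : ∑ a ∈ S, v a ^ 2 = U :=
    (Finset.sum_subset hAS fun x _ hx => by rw [hv x hx]; ring).symm
  have e2 : ∑ a ∈ S, v (a + t) ^ 2 = U :=
    sum_shift A S t (fun x => v x ^ 2) (fun x hx => by simp [hv x hx]) hSt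
  have e3 : ∑ a ∈ S, v a * v (a + t) = R := by
    rw [hR, corR, ← Finset.sum_subset hAS fun x _ hx => by rw [hv x hx]; ring]
    refine Finset.sum_congr rfl fun a _ => ?_
    rw [Finset.sum_eq_single (a + t)]
    · rw [if_pos (by omega)]
    · intro d _ hd
      rw [if_neg (by omega)]
    · intro h
      simp [hv _ h]
  have e4 : ∑ a ∈ S, v a ^ 2 * kk c a = midH A (fun x => v x ^ 2) c :=
    (Finset.sum_subset hAS fun x _ hx => by rw [hv x hx]; ring).symm
  have e5 : ∑ a ∈ S, v (a + t) ^ 2 * kk c a = midH A (fun x => v x ^ 2) b := by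
    rw [midH, ← sum_shift A S t (fun x => v x ^ 2 * kk b x) (fun x hx => by simp [hv x hx]) hSt]
    refine Finset.sum_congr rfl fun a _ => ?_
    have : kk c a = kk b (a + t) := by
      unfold kk
      congr 1
      · simp only [eq_iff_iff]; omega
      · congr 1; simp only [eq_iff_iff]; omega
    rw [this]
  have e6 : midH A (fun x => v x ^ 2) b - midH A (fun x => v x ^ 2) c
      = ∑ a ∈ S, (v (a+t) - v a) * ((v (a+t) + v a) * kk c a) := by
    rw [← e4, ← e5, ← Finset.sum_sub_distrib]
    exact Finset.sum_congr rfl fun a _ => by ring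
  have e7 : ∑ a ∈ S, (v (a+t) - v a)^2 = 2 * U - 2 * R := by
    have : 2 * U - 2 * R = U + U - 2 * R := by ring
    rw [this]
    nth_rewrite 1 [← e1]
    rw [← e2, ← e3, Finset.mul_sum, ← Finset.sum_add_distrib, ← Finset.sum_sub_distrib]
    exact Finset.sum_congr rfl fun a _ => by ring
  have e8 : ∑ a ∈ S, ((v (a+t) + v a) * kk c a)^2 ≤ 2 * U + 2 * R := by
    have : 2 * U + 2 * R = U + U + 2 * R := by ring
    rw [this]
    nth_rewrite 1 [← e1]
    rw [← e2, ← e3, Finset.mul_sum, ← Finset.sum_add_distrib, ← Finset.sum_add_distrib]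
    refine Finset.sum_le_sum fun a _ => ?_
    have h1 := kk_nonneg c a
    have h2 := kk_le c a
    have h3 : kk c a ^ 2 ≤ 1 := by nlinarith
    nlinarith [sq_nonneg (v (a+t) + v a)]
  rw [e6]
  refine (Finset.sum_mul_sq_le_sq_mul_sq _ _ _).trans ?_
  rw [e7]
  have h0 : 0 ≤ 2 * U - 2 * R := by rw [← e7]; positivity
  nlinarith [mul_le_mul_of_nonneg_left e8 h0]

lemma energy_le (A : Finset ℤ) (w : ℤ → ℝ) :
    enE A (fun x => w x ^ 3) ≤
      ∑ b ∈ A, ∑ c ∈ A, w b ^ 4 * w c ^ 4 * corR A (fun x => w x ^ 2) b c := by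
  have h1 : ∑ b ∈ A, ∑ c ∈ A, w b ^ 4 * w c ^ 4 * corR A (fun x => w x ^ 2) b c
     = ∑ a ∈ A, ∑ b ∈ A, ∑ c ∈ A, ∑ d ∈ A,
        if a + b = c + d then w b ^ 4 * w c ^ 4 * (w a ^ 2 * w d ^ 2) else 0 := by
    rw [Finset.sum_comm (s := A) (t := A) (f := fun a b => ∑ c ∈ A, ∑ d ∈ A,
        if a + b = c + d then w b ^ 4 * w c ^ 4 * (w a ^ 2 * w d ^ 2) else 0)]
    refine Finset.sum_congr rfl fun b _ => ?_
    rw [Finset.sum_comm (s := A) (t := A)]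
    refine Finset.sum_congr rfl fun c _ => ?_
    simp only [corR, Finset.mul_sum, mul_ite, mul_zero]
  have h2 : ∑ b ∈ A, ∑ c ∈ A, w b ^ 4 * w c ^ 4 * corR A (fun x => w x ^ 2) b c
     = ∑ a ∈ A, ∑ b ∈ A, ∑ c ∈ A, ∑ d ∈ A,
        if a + b = c + d then w a ^ 4 * w d ^ 4 * (w b ^ 2 * w c ^ 2) else 0 := by
    rw [h1, Finset.sum_comm]
    refine Finset.sum_congr rfl fun a _ => Finset.sum_congr rfl fun b _ => ?_
    rw [Finset.sum_comm]
    refine Finset.sum_congr rfl fun c _ => Finset.sum_congr rfl fun d _ => ?_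
    rw [add_comm b a, add_comm d c]
  have h3 : enE A (fun x => w x ^ 3) ≤ ∑ a ∈ A, ∑ b ∈ A, ∑ c ∈ A, ∑ d ∈ A,
        ((if a + b = c + d then w b ^ 4 * w c ^ 4 * (w a ^ 2 * w d ^ 2) else 0) +
        (if a + b = c + d then w a ^ 4 * w d ^ 4 * (w b ^ 2 * w c ^ 2) else 0)) / 2 := by
    unfold enE
    refine Finset.sum_le_sum fun a _ => Finset.sum_le_sum fun b _ => Finset.sum_le_sum fun c _ =>
      Finset.sum_le_sum fun d _ => ?_
    split_ifs
    · nlinarith [mul_nonneg (sq_nonneg (w a * w b * w c * w d))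
        (sq_nonneg (w b * w c - w a * w d))]
    · simp
  simp only [← Finset.sum_div, Finset.sum_add_distrib] at h3
  rw [← h1, ← h2] at h3
  linarith

lemma cor_le (A : Finset ℤ) (v : ℤ → ℝ) (hv : ∀ x, x ∉ A → v x = 0) (b c : ℤ) :
    corR A v b c ≤ ∑ x ∈ A, v x ^ 2 := by
  have h := cor_bound A v hv b c
  have h0 : 0 ≤ ∑ x ∈ A, v x ^ 2 := Finset.sum_nonneg fun _ _ => sq_nonneg _
  have h1 := sq_nonneg (midH A (fun x => v x ^ 2) b - midH A (fun x => v x ^ 2) c)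
  exact abs_le_of_sq_le_sq' (by linarith) h0 |>.2

lemma young4 (A : Finset ℤ) (w : ℤ → ℝ) (hw : ∀ x, x ∉ A → w x = 0) :
    enE A (fun x => w x ^ 3) ≤ (∑ x ∈ A, w x ^ 4) ^ 3 := by
  refine (energy_le A w).trans ?_
  have h : ∀ b ∈ A, ∀ c ∈ A, w b ^ 4 * w c ^ 4 * corR A (fun x => w x ^ 2) b c
      ≤ w b ^ 4 * w c ^ 4 * ∑ x ∈ A, w x ^ 4 := by
    intro b _ c _
    refine mul_le_mul_of_nonneg_left ?_ (by positivity)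
    refine (cor_le A (fun x => w x ^ 2) (fun x hx => by simp [hw x hx]) b c).trans_eq ?_
    exact Finset.sum_congr rfl fun x _ => by ring
  refine (Finset.sum_le_sum fun b hb => Finset.sum_le_sum fun c hc => h b hb c hc).trans_eq ?_
  simp only [← Finset.sum_mul, ← Finset.mul_sum]
  ring

lemma stab4 (A : Finset ℤ) (w : ℤ → ℝ) (hw : ∀ x, x ∉ A → w x = 0)
    (h1 : ∑ x ∈ A, w x ^ 4 = 1) :
    enE A (fun x => w x ^ 3) ≤ 1 - (1 - ∑ x ∈ A, (w x ^ 4) ^ 3) / 48 := by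
  refine (energy_le A w).trans ?_
  have e : (fun x => (w x ^ 2) ^ 2) = fun x => w x ^ 4 := by
    funext x; ring
  have h : ∀ b ∈ A, ∀ c ∈ A, w b ^ 4 * w c ^ 4 * corR A (fun x => w x ^ 2) b c
      ≤ w b ^ 4 * w c ^ 4 - (w b ^ 4 * w c ^ 4 *
        (midH A (fun x => w x ^ 4) b - midH A (fun x => w x ^ 4) c) ^ 2) * (1 / 8) := by
    intro b _ c _
    have h2 := cor_bound A (fun x => w x ^ 2) (fun x hx => by simp [hw x hx]) b c
    have h3 := cor_le A (fun x => w x ^ 2) (fun x hx => by simp [hw x hx]) b c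
    simp only [e] at h2 h3
    rw [h1] at h2 h3
    have h4 : corR A (fun x => w x ^ 2) b c ≤ 1 -
      (midH A (fun x => w x ^ 4) b - midH A (fun x => w x ^ 4) c) ^ 2 * (1 / 8) := by
      nlinarith [sq_nonneg (1 - corR A (fun x => w x ^ 2) b c)]
    have h5 : 0 ≤ w b ^ 4 * w c ^ 4 := by positivity
    nlinarith [mul_le_mul_of_nonneg_left h4 h5]
  refine (Finset.sum_le_sum fun b hb => Finset.sum_le_sum fun c hc => h b hb c hc).trans_eq ?_
  simp only [Finset.sum_sub_distrib, ← Finset.sum_mul, ← Finset.mul_sum]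
  rw [var_ident (fun x => w x ^ 4) A h1]
  simp only [h1]
  ring

lemma cube_root {x : ℝ} (hx : 0 ≤ x) : (x ^ ((1:ℝ)/3)) ^ 3 = x ∧
    (x ^ ((1:ℝ)/3)) ^ 4 = x ^ ((4:ℝ)/3) := by
  constructor
  · rw [← Real.rpow_natCast, ← Real.rpow_mul hx]; norm_num
  · rw [← Real.rpow_natCast, ← Real.rpow_mul hx]; norm_num

lemma youngF (A : Finset ℤ) (f : ℤ → ℝ) (hf : ∀ x, x ∉ A → f x = 0) (h0 : ∀ x, 0 ≤ f x) :
    enE A f ≤ (∑ x ∈ A, f x ^ ((4:ℝ)/3)) ^ 3 := by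
  have h := young4 A (fun x => f x ^ ((1:ℝ)/3)) (fun x hx => by
    simp only [hf x hx]; exact Real.zero_rpow (by norm_num))
  simpa only [fun x => (cube_root (h0 x)).1, fun x => (cube_root (h0 x)).2] using h

lemma stabF (A : Finset ℤ) (f : ℤ → ℝ) (hf : ∀ x, x ∉ A → f x = 0) (h0 : ∀ x, 0 ≤ f x)
    (h1 : ∑ x ∈ A, f x ^ ((4:ℝ)/3) = 1) (M : ℝ) (hM1 : M ≤ 1) (hM : ∀ x ∈ A, f x ^ ((4:ℝ)/3) ≤ M) :
    enE A f ≤ 1 - (1 - M) / 48 := by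
  have h := stab4 A (fun x => f x ^ ((1:ℝ)/3)) (fun x hx => by
    simp only [hf x hx]; exact Real.zero_rpow (by norm_num))
  simp only [fun x => (cube_root (h0 x)).1, fun x => (cube_root (h0 x)).2] at h
  refine (h h1).trans ?_
  have : ∑ x ∈ A, (f x ^ ((4:ℝ)/3)) ^ 3 ≤ ∑ x ∈ A, f x ^ ((4:ℝ)/3) * M := by
    refine Finset.sum_le_sum fun x hx => ?_
    have a0 : 0 ≤ f x ^ ((4:ℝ)/3) := Real.rpow_nonneg (h0 x) _
    have a1 := hM x hx
    have a2 : (f x ^ ((4:ℝ)/3)) ^ 2 ≤ M := by nlinarith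
    nlinarith [mul_le_mul_of_nonneg_left a2 a0]
  rw [← Finset.sum_mul, h1] at this
  linarith

lemma holderF (A : Finset ℤ) (f : ℤ → ℝ) (h0 : ∀ x, 0 ≤ f x) (δ K : ℝ) (hδ : 0 < δ) (hδ' : δ ≤ 1/3)
    (hK : (A.card : ℝ) ^ δ = K) :
    (∑ x ∈ A, f x ^ ((4:ℝ)/3)) ^ 3 ≤ K * (∑ x ∈ A, f x ^ (4 / (3 - δ))) ^ (3 - δ) := by
  set X := ∑ x ∈ A, f x ^ ((4:ℝ)/3) with hX
  set Y := ∑ x ∈ A, f x ^ (4 / (3 - δ)) with hY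
  have hX0 : 0 ≤ X := Finset.sum_nonneg fun _ _ => Real.rpow_nonneg (h0 _) _
  have hY0 : 0 ≤ Y := Finset.sum_nonneg fun _ _ => Real.rpow_nonneg (h0 _) _
  have hp : 1 ≤ 3 / (3 - δ) := by rw [le_div_iff₀ (by linarith)]; linarith
  have h := Real.rpow_sum_le_const_mul_sum_rpow A (fun x => f x ^ ((4:ℝ)/3)) hp
  have e : ∑ x ∈ A, |f x ^ ((4:ℝ)/3)| ^ (3 / (3 - δ)) = Y := by
    refine Finset.sum_congr rfl fun x _ => ?_
    rw [abs_of_nonneg (Real.rpow_nonneg (h0 _) _), ← Real.rpow_mul (h0 x)]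
    congr 1; ring
  have e1 : ∑ x ∈ A, |f x ^ ((4:ℝ)/3)| = X :=
    Finset.sum_congr rfl fun x _ => abs_of_nonneg (Real.rpow_nonneg (h0 _) _)
  rw [e, e1] at h
  have h2 := Real.rpow_le_rpow (Real.rpow_nonneg hX0 _) h (z := 3 - δ) (by linarith)
  have hne : (3 - δ) ≠ 0 := by linarith
  rw [← Real.rpow_mul hX0, Real.mul_rpow (by positivity) hY0, ← Real.rpow_mul (by positivity),
    div_mul_cancel₀ _ hne, show (3 / (3 - δ) - 1) * (3 - δ) = δ by field_simp; ring, hK] at h2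
  exact_mod_cast h2

noncomputable def rep (A : Finset ℤ) (f : ℤ → ℝ) (s : ℤ) : ℝ := ∑ a ∈ A, f a * f (s - a)

lemma energy_rep (A S : Finset ℤ) (f : ℤ → ℝ) (hf : ∀ x, x ∉ A → f x = 0)
    (hS : ∀ x ∈ A, ∀ y ∈ A, x + y ∈ S) : enE A f = ∑ s ∈ S, rep A f s ^ 2 := by
  have h1 : ∀ a b c : ℤ, ∑ d ∈ A, (if a + b = c + d then f a * f b * (f c * f d) else 0)
      = f a * f b * (f c * f (a + b - c)) := by
    intro a b c
    rw [Finset.sum_eq_single (a + b - c)]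
    · rw [if_pos (by omega)]
    · intro d _ hd
      rw [if_neg (by omega)]
    · intro h
      simp [hf _ h]
  have h2 : ∀ a b : ℤ, ∑ c ∈ A, f a * f b * (f c * f (a + b - c)) = f a * f b * rep A f (a + b) := by
    intro a b
    rw [rep, Finset.mul_sum]
  have h3 : ∀ a ∈ A, ∑ b ∈ A, f a * f b * rep A f (a + b)
      = ∑ s ∈ S, f a * f (s - a) * rep A f s := by
    intro a ha
    rw [← sum_shift A S (-a) (fun b => f a * f b * rep A f (a + b)) (fun x hx => by simp [hf x hx])
      (fun x hx => by rw [sub_neg_eq_add]; exact hS x hx a ha)]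
    refine Finset.sum_congr rfl fun s _ => ?_
    rw [show a + (s + -a) = s by ring, show s + -a = s - a by ring]
  unfold enE
  simp only [h1, h2]
  rw [Finset.sum_congr rfl h3, Finset.sum_comm]
  refine Finset.sum_congr rfl fun s _ => ?_
  rw [← Finset.sum_mul, sq]
  rfl

lemma near_energy (A : Finset ℤ) (f : ℤ → ℝ) (hf : ∀ x, x ∉ A → f x = 0)
    (m : ℤ) (hm : m ∈ A) (hfm : f m = 1) (g : ℤ → ℝ) (hg : g = fun x => if x = m then 0 else f x) :
    enE A f ≤ 1 + 8 * ∑ x ∈ A, g x ^ 2 + 3 * enE A g := by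
  classical
  set S := (A ×ˢ A).image (fun p => p.1 + p.2) with hS
  have hSS : ∀ x ∈ A, ∀ y ∈ A, x + y ∈ S := fun x hx y hy =>
    Finset.mem_image.2 ⟨(x, y), Finset.mem_product.2 ⟨hx, hy⟩, rfl⟩
  have hgA : ∀ x, x ∉ A → g x = 0 := by
    intro x hx; rw [hg]; simp [hf x hx]
  have hgm : g m = 0 := by simp [hg]
  set D : ℤ → ℝ := fun x => if x = m then 1 else 0 with hD
  have hfD : ∀ x, f x = D x + g x := by
    intro x
    by_cases h : x = m <;> simp [hD, hg, h, hfm]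
  have hrep : ∀ s, rep A f s = D (s - m) + 2 * g (s - m) + rep A g s := by
    intro s
    have t1 : ∑ a ∈ A, D a * D (s - a) = D (s - m) := by
      rw [Finset.sum_eq_single_of_mem m hm]
      · simp [hD]
      · intro b _ hb; simp [hD, hb]
    have t2 : ∑ a ∈ A, D a * g (s - a) = g (s - m) := by
      rw [Finset.sum_eq_single_of_mem m hm]
      · simp [hD]
      · intro b _ hb; simp [hD, hb]
    have t3 : ∑ a ∈ A, g a * D (s - a) = g (s - m) := by
      rw [Finset.sum_eq_single (s - m)]
      · simp [hD]
      · intro b _ hb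
        have : s - b ≠ m := by omega
        simp [hD, this]
      · intro h; simp [hgA _ h]
    have t4 : rep A f s = ∑ a ∈ A, (D a * D (s - a) + D a * g (s - a) + g a * D (s - a)
        + g a * g (s - a)) := by
      refine Finset.sum_congr rfl fun a _ => ?_
      rw [hfD a, hfD (s - a)]; ring
    rw [t4, Finset.sum_add_distrib, Finset.sum_add_distrib, Finset.sum_add_distrib, t1, t2, t3, rep]
    ring
  have hpt : ∀ s ∈ S, rep A f s ^ 2 ≤ D (s - m) * (1 + 2 * rep A g (2 * m)) + 6 * g (s - m) ^ 2
      + 3 * rep A g s ^ 2 := by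
    intro s _
    rw [hrep s]
    by_cases h : s - m = m
    · have h2 : s = 2 * m := by omega
      rw [h, hgm, ← h2]
      simp only [hD, if_true]
      nlinarith [sq_nonneg (rep A g s)]
    · simp only [hD, if_neg h]
      nlinarith [sq_nonneg (g (s - m) - rep A g s)]
  have s1 : ∑ s ∈ S, D (s - m) = 1 := by
    rw [Finset.sum_eq_single_of_mem (m + m) (hSS m hm m hm)]
    · simp [hD]
    · intro b _ hb
      have : b - m ≠ m := by omega
      simp [hD, this]
  have s2 : ∑ s ∈ S, g (s - m) ^ 2 = ∑ x ∈ A, g x ^ 2 := by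
    have := sum_shift A S (-m) (fun x => g x ^ 2) (fun x hx => by simp [hgA x hx])
      (fun x hx => by rw [sub_neg_eq_add]; exact hSS x hx m hm)
    simpa only [← sub_eq_add_neg] using this
  have s3 : ∑ a ∈ A, g (2 * m - a) ^ 2 ≤ ∑ x ∈ A, g x ^ 2 := by
    have e1 : ∑ a ∈ A, g (2 * m - a) ^ 2 = ∑ y ∈ A.image (fun a => 2 * m - a), g y ^ 2 := by
      rw [Finset.sum_image]
      intro x _ y _ h
      simpa using h
    rw [e1, Finset.sum_subset (Finset.subset_union_right (s₁ := A.image (fun a => 2 * m - a)) (s₂ := A))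
      (fun x _ hx => by rw [hgA x hx]; ring)]
    exact Finset.sum_le_sum_of_subset_of_nonneg Finset.subset_union_left
      (fun _ _ _ => sq_nonneg _)
  have s4 : 2 * rep A g (2 * m) ≤ 2 * ∑ x ∈ A, g x ^ 2 := by
    have : 2 * rep A g (2 * m) ≤ ∑ a ∈ A, (g a ^ 2 + g (2 * m - a) ^ 2) := by
      rw [rep, Finset.mul_sum]
      refine Finset.sum_le_sum fun a _ => ?_
      nlinarith [sq_nonneg (g a - g (2 * m - a))]
    rw [Finset.sum_add_distrib] at this
    linarith
  rw [energy_rep A S f hf hSS, energy_rep A S g hgA hSS]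
  refine (Finset.sum_le_sum hpt).trans ?_
  rw [Finset.sum_add_distrib, Finset.sum_add_distrib, ← Finset.sum_mul, ← Finset.mul_sum,
    ← Finset.mul_sum, s1, s2]
  linarith

lemma near_case (A : Finset ℤ) (f : ℤ → ℝ) (hf : ∀ x, x ∉ A → f x = 0) (h0 : ∀ x, 0 ≤ f x)
    (m : ℤ) (hm : m ∈ A) (hfm : f m = 1) (hG : ∑ x ∈ A.erase m, f x ^ ((4:ℝ)/3) ≤ 1/100)
    (δ : ℝ) (hδ : 0 < δ) (hδ' : δ ≤ 1/3) (hK : (A.card : ℝ) ^ δ = 1 + 1/5000) :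
    enE A f ≤ (∑ x ∈ A, f x ^ (4 / (3 - δ))) ^ (3 - δ) := by
  set g : ℤ → ℝ := fun x => if x = m then 0 else f x with hg
  have hgA : ∀ x, x ∉ A → g x = 0 := by
    intro x hx; rw [hg]; simp [hf x hx]
  have hg0 : ∀ x, 0 ≤ g x := by
    intro x; simp only [hg]; split_ifs
    · exact le_rfl
    · exact h0 x
  have hgm : g m = 0 := by simp [hg]
  set q := 4 / (3 - δ) with hq
  have hq1 : 4/3 ≤ q := by rw [hq, le_div_iff₀ (by linarith)]; linarith
  have hq2 : q ≤ 3/2 := by rw [hq, div_le_iff₀ (by linarith)]; linarith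
  have esum : ∀ p : ℝ, 0 < p → ∑ x ∈ A.erase m, f x ^ p = ∑ x ∈ A, g x ^ p := by
    intro p hp
    rw [← Finset.add_sum_erase A _ hm, hgm, Real.zero_rpow hp.ne', zero_add]
    refine Finset.sum_congr rfl fun x hx => ?_
    simp [hg, Finset.ne_of_mem_erase hx]
  have hG' : ∑ x ∈ A, g x ^ ((4:ℝ)/3) ≤ 1/100 := by rw [← esum _ (by norm_num)]; exact hG
  set Q := ∑ x ∈ A, g x ^ q with hQ
  have hfQ : ∑ x ∈ A, f x ^ q = 1 + Q := by
    rw [← Finset.add_sum_erase A _ hm, hfm, Real.one_rpow, esum q (by linarith)]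
  have hg25 : ∀ x ∈ A, g x ≤ 1/25 := by
    intro x hx
    by_contra hc
    push Not at hc
    have h1 : g x ^ ((4:ℝ)/3) ≤ 1/100 :=
      (Finset.single_le_sum (f := fun x => g x ^ ((4:ℝ)/3))
        (fun i _ => Real.rpow_nonneg (hg0 i) _) hx).trans hG'
    have h2 : (g x ^ ((4:ℝ)/3)) ^ 3 = g x ^ 4 := by
      rw [← Real.rpow_natCast, ← Real.rpow_mul (hg0 x)]
      norm_num
    have h3 : (g x ^ ((4:ℝ)/3)) ^ 3 ≤ (1/100) ^ 3 := pow_le_pow_left₀ (Real.rpow_nonneg (hg0 x) _) h1 3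
    have h4 : (1/25 : ℝ) ^ 4 ≤ g x ^ 4 := pow_le_pow_left₀ (by norm_num) hc.le 4
    rw [h2] at h3
    norm_num at h3 h4
    linarith
  have hQ0 : 0 ≤ Q := Finset.sum_nonneg fun x _ => Real.rpow_nonneg (hg0 x) _
  have hQ1 : Q ≤ 1/100 := by
    refine le_trans (Finset.sum_le_sum fun x hx => ?_) hG'
    have := hg25 x hx
    exact Real.rpow_le_rpow_of_exponent_ge_of_imp (hg0 x) (by linarith) hq1 (by intro _ h; exfalso; linarith)
  have hS2 : ∑ x ∈ A, g x ^ 2 ≤ 1/5 * Q := by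
    rw [hQ, Finset.mul_sum]
    refine Finset.sum_le_sum fun x hx => ?_
    rcases (hg0 x).eq_or_lt with h | h
    · rw [← h, Real.zero_rpow (by linarith)]; norm_num
    · have e1 : g x ^ 2 = g x ^ (2 - q) * g x ^ q := by
        rw [← Real.rpow_add h, ← Real.rpow_natCast]; norm_num
      rw [e1]
      refine mul_le_mul_of_nonneg_right ?_ (Real.rpow_nonneg (hg0 x) _)
      have h25 := hg25 x hx
      calc g x ^ (2 - q) ≤ g x ^ ((1:ℝ)/2) :=
            Real.rpow_le_rpow_of_exponent_ge h (by linarith) (by linarith)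
        _ ≤ (1/25 : ℝ) ^ ((1:ℝ)/2) := Real.rpow_le_rpow h.le h25 (by norm_num)
        _ = 1/5 := by
            rw [← Real.sqrt_eq_rpow, show (1/25:ℝ) = (1/5)^2 by norm_num]
            exact Real.sqrt_sq (by norm_num)
  have hEg : enE A g ≤ 1/50 * Q := by
    have h1 := (youngF A g hgA hg0).trans (holderF A g hg0 δ _ hδ hδ' hK)
    rw [← hq, ← hQ] at h1
    have h2 : Q ^ (3 - δ) ≤ Q ^ (2:ℝ) :=
      Real.rpow_le_rpow_of_exponent_ge_of_imp hQ0 (by linarith) (by linarith)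
        (by intro _ h; exfalso; linarith)
    rw [Real.rpow_two] at h2
    nlinarith
  have hB : 1 + (3 - δ) * Q ≤ (1 + Q) ^ (3 - δ) :=
    one_add_mul_self_le_rpow_one_add (by linarith) (by linarith)
  rw [hfQ]
  have := near_energy A f hf m hm hfm g hg
  nlinarith

lemma enE_smul (A : Finset ℤ) (f : ℤ → ℝ) (s : ℝ) : enE A (fun x => s * f x) = s ^ 4 * enE A f := by
  unfold enE
  simp only [Finset.mul_sum, mul_ite, mul_zero]
  refine Finset.sum_congr rfl fun a _ => Finset.sum_congr rfl fun b _ =>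
    Finset.sum_congr rfl fun c _ => Finset.sum_congr rfl fun d _ => ?_
  congr 1
  ring

lemma rhs_smul (A : Finset ℤ) (f : ℤ → ℝ) (h0 : ∀ x, 0 ≤ f x) (s : ℝ) (hs : 0 < s) (δ : ℝ)
    (hδ' : δ ≤ 1/3) :
    (∑ x ∈ A, (s * f x) ^ (4 / (3 - δ))) ^ (3 - δ)
      = s ^ 4 * (∑ x ∈ A, f x ^ (4 / (3 - δ))) ^ (3 - δ) := by
  have : ∑ x ∈ A, (s * f x) ^ (4 / (3 - δ)) = s ^ (4 / (3 - δ)) * ∑ x ∈ A, f x ^ (4 / (3 - δ)) := by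
    rw [Finset.mul_sum]
    exact Finset.sum_congr rfl fun x _ => Real.mul_rpow hs.le (h0 x)
  rw [this, Real.mul_rpow (by positivity) (Finset.sum_nonneg fun x _ => Real.rpow_nonneg (h0 x) _),
    ← Real.rpow_mul hs.le, div_mul_cancel₀ _ (by linarith)]
  congr 1
  exact_mod_cast Real.rpow_natCast s 4

lemma core (A : Finset ℤ) (f : ℤ → ℝ) (hf : ∀ x, x ∉ A → f x = 0) (h0 : ∀ x, 0 ≤ f x)
    (m : ℤ) (hm : m ∈ A) (hfm : 0 < f m) (hmax : ∀ x ∈ A, f x ≤ f m)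
    (δ : ℝ) (hδ : 0 < δ) (hδ' : δ ≤ 1/3) (hK : (A.card : ℝ) ^ δ = 1 + 1/5000) :
    enE A f ≤ (∑ x ∈ A, f x ^ (4 / (3 - δ))) ^ (3 - δ) := by
  have key : ∀ s : ℝ, 0 < s → enE A (fun x => s * f x) ≤
      (∑ x ∈ A, (s * f x) ^ (4 / (3 - δ))) ^ (3 - δ) →
      enE A f ≤ (∑ x ∈ A, f x ^ (4 / (3 - δ))) ^ (3 - δ) := by
    intro s hs h
    rw [enE_smul, rhs_smul A f h0 s hs δ hδ'] at h
    exact le_of_mul_le_mul_left h (by positivity)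
  set X := ∑ x ∈ A, f x ^ ((4:ℝ)/3) with hX
  set M := f m ^ ((4:ℝ)/3) with hM
  have hMpos : 0 < M := Real.rpow_pos_of_pos hfm _
  have hXM : X = M + ∑ x ∈ A.erase m, f x ^ ((4:ℝ)/3) := (Finset.add_sum_erase A _ hm).symm
  have hge : 0 ≤ ∑ x ∈ A.erase m, f x ^ ((4:ℝ)/3) :=
    Finset.sum_nonneg fun x _ => Real.rpow_nonneg (h0 x) _
  have hXpos : 0 < X := by linarith
  by_cases hc : ∑ x ∈ A.erase m, f x ^ ((4:ℝ)/3) ≤ 1/100 * M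
  · apply key (f m)⁻¹ (inv_pos.2 hfm)
    refine near_case A _ (fun x hx => by simp [hf x hx])
      (fun x => mul_nonneg (inv_pos.2 hfm).le (h0 x)) m hm (inv_mul_cancel₀ hfm.ne') ?_ δ hδ hδ' hK
    have : ∀ x ∈ A.erase m, ((f m)⁻¹ * f x) ^ ((4:ℝ)/3) = M⁻¹ * f x ^ ((4:ℝ)/3) := by
      intro x _
      rw [Real.mul_rpow (inv_pos.2 hfm).le (h0 x), Real.inv_rpow hfm.le]
    rw [Finset.sum_congr rfl this, ← Finset.mul_sum, inv_mul_le_iff₀ hMpos]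
    linarith
  · push Not at hc
    have hs : 0 < X ^ (-(3:ℝ)/4) := Real.rpow_pos_of_pos hXpos _
    apply key _ hs
    set s := X ^ (-(3:ℝ)/4) with hsd
    have hs43 : s ^ ((4:ℝ)/3) = X⁻¹ := by
      rw [hsd, ← Real.rpow_mul hXpos.le, ← Real.rpow_neg_one]; norm_num
    have hpw : ∀ x, (s * f x) ^ ((4:ℝ)/3) = X⁻¹ * f x ^ ((4:ℝ)/3) := by
      intro x
      rw [Real.mul_rpow hs.le (h0 x), hs43]
    have hsum : ∑ x ∈ A, (s * f x) ^ ((4:ℝ)/3) = 1 := by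
      simp only [hpw]
      rw [← Finset.mul_sum]
      exact inv_mul_cancel₀ hXpos.ne'
    have hnn : ∀ x, 0 ≤ s * f x := fun x => mul_nonneg hs.le (h0 x)
    have h1 := stabF A (fun x => s * f x) (fun x hx => by simp [hf x hx]) hnn
      hsum (100/101) (by norm_num) (by
        intro x hx
        rw [hpw, inv_mul_le_iff₀ hXpos]
        have : f x ^ ((4:ℝ)/3) ≤ M := Real.rpow_le_rpow (h0 x) (hmax x hx) (by norm_num)
        linarith)
    have h2 := holderF A (fun x => s * f x) hnn δ _ hδ hδ' hK
    simp only [hsum] at h2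
    norm_num at h1 h2
    linarith

lemma int_char (k : ℤ) :
    ∫ θ in (0:ℝ)..1, Complex.exp (-2 * π * I * k * θ) = if k = 0 then 1 else 0 := by
  split_ifs with h
  · simp [h]
  · have hc : (-2 * π * I * k : ℂ) ≠ 0 := by
      simp [Real.pi_ne_zero, h]
    rw [integral_exp_mul_complex hc]
    have : Complex.exp (-2 * π * I * k * (1:ℝ)) = 1 := by
      rw [Complex.exp_eq_one_iff]
      exact ⟨-k, by push_cast; ring⟩
    rw [this]
    simp

lemma integral_energy (A : Finset ℤ) (f : ℤ → ℝ) :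
    ∫ θ in (0:ℝ)..1, ‖∑ a ∈ A, (f a : ℂ) * Complex.exp (-2 * π * I * a * θ)‖ ^ 4 = enE A f := by
  have hpt : ∀ θ : ℝ, ((‖∑ a ∈ A, (f a : ℂ) * Complex.exp (-2 * π * I * a * θ)‖ ^ 4 : ℝ) : ℂ)
      = ∑ a ∈ A, ∑ b ∈ A, ∑ c ∈ A, ∑ d ∈ A, ((f a * f b * (f c * f d) : ℝ) : ℂ) *
        Complex.exp (-2 * π * I * ((a + b - (c + d) : ℤ) : ℂ) * θ) := by
    intro θ
    set z := ∑ a ∈ A, (f a : ℂ) * Complex.exp (-2 * π * I * a * θ) with hz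
    have hconj : (starRingEnd ℂ) z = ∑ a ∈ A, (f a : ℂ) * Complex.exp (2 * π * I * a * θ) := by
      rw [hz, map_sum]
      refine Finset.sum_congr rfl fun a _ => ?_
      rw [map_mul, Complex.conj_ofReal, ← Complex.exp_conj]
      congr 2
      simp
      exact Or.inl (Or.inl (Complex.conj_ofNat 2))
    have h1 : ((‖z‖ ^ 4 : ℝ) : ℂ) = z * (z * ((starRingEnd ℂ) z * (starRingEnd ℂ) z)) := by
      have := Complex.mul_conj' z
      push_cast
      calc (‖z‖ : ℂ) ^ 4 = ((‖z‖ : ℂ) ^ 2) * ((‖z‖ : ℂ) ^ 2) := by ring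
        _ = _ := by rw [← this]; ring
    rw [h1, hconj, hz]
    rw [Finset.sum_mul]
    refine Finset.sum_congr rfl fun a _ => ?_
    rw [Finset.sum_mul, Finset.mul_sum]
    refine Finset.sum_congr rfl fun b _ => ?_
    rw [Finset.sum_mul, Finset.mul_sum, Finset.mul_sum]
    refine Finset.sum_congr rfl fun c _ => ?_
    rw [Finset.mul_sum, Finset.mul_sum, Finset.mul_sum]
    refine Finset.sum_congr rfl fun d _ => ?_
    have : Complex.exp (-2 * π * I * ((a + b - (c + d) : ℤ) : ℂ) * θ)
      = Complex.exp (-2 * π * I * a * θ) * (Complex.exp (-2 * π * I * b * θ) *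
        (Complex.exp (2 * π * I * c * θ) * Complex.exp (2 * π * I * d * θ))) := by
      rw [← Complex.exp_add, ← Complex.exp_add, ← Complex.exp_add]
      congr 1
      push_cast; ring
    rw [this]
    push_cast; ring
  have hint : ∀ (r : ℂ) (k : ℤ), IntervalIntegrable
      (fun θ : ℝ => r * Complex.exp (-2 * π * I * (k : ℂ) * θ)) MeasureTheory.volume 0 1 :=
    fun r k => Continuous.intervalIntegrable (by fun_prop) _ _
  apply Complex.ofReal_injective
  rw [← intervalIntegral.integral_ofReal]
  simp only [hpt]
  unfold enE
  push_cast
  rw [intervalIntegral.integral_finsetSum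
    (fun a _ => Continuous.intervalIntegrable (by fun_prop) _ _)]
  refine Finset.sum_congr rfl fun a _ => ?_
  rw [intervalIntegral.integral_finsetSum
    (fun a _ => Continuous.intervalIntegrable (by fun_prop) _ _)]
  refine Finset.sum_congr rfl fun b _ => ?_
  rw [intervalIntegral.integral_finsetSum
    (fun a _ => Continuous.intervalIntegrable (by fun_prop) _ _)]
  refine Finset.sum_congr rfl fun c _ => ?_
  rw [intervalIntegral.integral_finsetSum
    (fun a _ => Continuous.intervalIntegrable (by fun_prop) _ _)]
  refine Finset.sum_congr rfl fun d _ => ?_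
  rw [intervalIntegral.integral_const_mul]
  have := int_char (a + b - (c + d))
  push_cast at this
  rw [this]
  by_cases h : a + b = c + d
  · rw [if_pos (by omega), if_pos h]; push_cast; ring
  · rw [if_neg (by omega), if_neg h]; simp

lemma enE_le_abs (A : Finset ℤ) (f : ℤ → ℝ) : enE A f ≤ enE A (fun x => |f x|) := by
  unfold enE
  refine Finset.sum_le_sum fun a _ => Finset.sum_le_sum fun b _ => Finset.sum_le_sum fun c _ =>
      Finset.sum_le_sum fun d _ => ?_
  split_ifs
  · rw [← abs_mul, ← abs_mul, ← abs_mul]; exact le_abs_self _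
  · exact le_rfl

/-- Upper bound for `t_n`: there is an absolute constant `c > 0` such that every real
function on ℤ supported on a set of size `n` satisfies `‖f̂‖₄ ≤ ‖f‖_q` with
`q = 4/(3 - log_n(1+c))`. -/
theorem stmt_13 :
    ∃ c > (0:ℝ), ∀ n : ℕ, 2 ≤ n → ∀ f : ℤ → ℝ,
      ∀ hf : (Function.support f).Finite, hf.toFinset.card = n →
      (∫ θ in (0:ℝ)..1,
          ‖∑' a : ℤ, (f a : ℂ) * Complex.exp (-2 * π * I * a * θ)‖ ^ 4) ^ ((1:ℝ)/4)
        ≤ (∑' a : ℤ, |f a| ^ (4 / (3 - Real.logb n (1 + c))))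
            ^ (1 / (4 / (3 - Real.logb n (1 + c)))) := by
  refine ⟨1/5000, by norm_num, ?_⟩
  intro n hn f hf hcard
  have hn' : (2:ℝ) ≤ n := by exact_mod_cast hn
  set δ := Real.logb n (1 + 1/5000) with hδd
  have hδ : 0 < δ := Real.logb_pos (by linarith) (by norm_num)
  have hK : (n : ℝ) ^ δ = 1 + 1/5000 :=
    Real.rpow_logb (by linarith) (by linarith) (by norm_num)
  have hδ' : δ ≤ 1/3 := by
    by_contra hc
    push Not at hc
    have h1 : (n : ℝ) ^ ((1:ℝ)/3) ≤ 1 + 1/5000 := by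
      rw [← hK]; exact Real.rpow_le_rpow_of_exponent_le (by linarith) hc.le
    have h2 := (cube_root (x := (n:ℝ)) (by linarith)).1
    have h3 := pow_le_pow_left₀ (Real.rpow_nonneg (by linarith) _) h1 3
    rw [h2] at h3
    norm_num at h3
    linarith
  set A := hf.toFinset with hA
  have hfA : ∀ x, x ∉ A → f x = 0 := by
    intro x hx
    simpa [hA] using hx
  have hne : A.Nonempty := by rw [← Finset.card_pos]; omega
  obtain ⟨m, hm, hmax⟩ := Finset.exists_max_image A (fun x => |f x|) hne
  have hfm : 0 < |f m| := by
    have : f m ≠ 0 := by simpa [hA] using hm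
    exact abs_pos.2 this
  have hq : 4 / (3 - δ) ≠ 0 := by
    have : 0 < 3 - δ := by linarith
    positivity
  have e1 : ∀ θ : ℝ, ∑' a : ℤ, (f a : ℂ) * Complex.exp (-2 * π * I * a * θ)
      = ∑ a ∈ A, (f a : ℂ) * Complex.exp (-2 * π * I * a * θ) := fun θ =>
    tsum_eq_sum fun x hx => by simp [hfA x hx]
  have e2 : ∑' a : ℤ, |f a| ^ (4 / (3 - δ)) = ∑ a ∈ A, |f a| ^ (4 / (3 - δ)) :=
    tsum_eq_sum fun x hx => by simp only [hfA x hx, abs_zero]; exact Real.zero_rpow hq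
  simp only [e1]
  rw [e2]
  have hmain : ∫ θ in (0:ℝ)..1, ‖∑ a ∈ A, (f a : ℂ) * Complex.exp (-2 * π * I * a * θ)‖ ^ 4
      ≤ (∑ a ∈ A, |f a| ^ (4 / (3 - δ))) ^ (3 - δ) := by
    rw [integral_energy]
    exact (enE_le_abs A f).trans (core A (fun x => |f x|) (fun x hx => by simp [hfA x hx])
      (fun x => abs_nonneg _) m hm hfm hmax δ hδ hδ' (by rw [hcard]; exact hK))
  have hint0 : 0 ≤ ∫ θ in (0:ℝ)..1, ‖∑ a ∈ A, (f a : ℂ) * Complex.exp (-2 * π * I * a * θ)‖ ^ 4 :=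
    intervalIntegral.integral_nonneg (by norm_num) fun _ _ => by positivity
  refine (Real.rpow_le_rpow hint0 hmain (by norm_num)).trans_eq ?_
  rw [← Real.rpow_mul (Finset.sum_nonneg fun x _ => Real.rpow_nonneg (abs_nonneg _) _)]
  congr 1
  rw [one_div_div]; ring
end

section
/- For every ε > 0 and every sufficiently large n (in terms of ε), with q = 4/(3-(1+ε)log_n(3√3/4)), there exists a function f : ℤ → ℝ supported on an interval of length n such that ‖f̂‖_{L⁴(ℝ/ℤ)} > ‖f‖_{ℓ^q}. -/
open Real Complex
open Filter Topology MeasureTheory in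
theorem riemann_aux (ψ : ℝ → ℂ) (hψ : Continuous ψ) :
    Tendsto (fun n : ℕ => (1 / (n:ℂ)) * ∑ k ∈ Finset.range n, ψ ((k:ℝ) / n)) atTop
      (𝓝 (∫ u in (0:ℝ)..1, ψ u)) := by
  rw [Metric.tendsto_atTop]
  intro e he
  have huc : UniformContinuousOn ψ (Set.Icc 0 1) :=
    isCompact_Icc.uniformContinuousOn_of_continuous hψ.continuousOn
  rw [Metric.uniformContinuousOn_iff] at huc
  obtain ⟨d, hd, h⟩ := huc (e/2) (by positivity)
  obtain ⟨N, hN⟩ := exists_nat_gt (1/d)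
  refine ⟨N+1, fun n hn => ?_⟩
  have hnpos : (0:ℝ) < n := by
    have : 0 < n := by omega
    exact_mod_cast this
  have hnd : 1 / (n:ℝ) < d := by
    have : (N:ℝ) ≤ n := by exact_mod_cast (by omega : N ≤ n)
    rw [div_lt_iff₀ hnpos]
    rw [div_lt_iff₀ hd] at hN
    nlinarith
  have hsum : ∫ u in (0:ℝ)..1, ψ u
      = ∑ k ∈ Finset.range n, ∫ u in ((k:ℝ)/n)..(((k+1:ℕ):ℝ)/n), ψ u := by
    rw [intervalIntegral.sum_integral_adjacent_intervals (a := fun k : ℕ => (k:ℝ)/n)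
      (fun k _ => hψ.intervalIntegrable _ _)]
    simp [hnpos.ne']
  rw [hsum, dist_eq_norm, Finset.mul_sum, ← Finset.sum_sub_distrib]
  have hb : ∀ k ∈ Finset.range n, ‖1 / (n:ℂ) * ψ ((k:ℝ)/n)
      - ∫ u in ((k:ℝ)/n)..(((k+1:ℕ):ℝ)/n), ψ u‖ ≤ e/2 * (1/n) := by
    intro k hk
    have hk' : ((k:ℝ)+1) ≤ n := by exact_mod_cast Finset.mem_range.mp hk
    have hlen : ((k+1:ℕ):ℝ)/n - (k:ℝ)/n = 1/n := by push_cast; ring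
    have hc : 1 / (n:ℂ) * ψ ((k:ℝ)/n) = ∫ u in ((k:ℝ)/n)..(((k+1:ℕ):ℝ)/n), ψ ((k:ℝ)/n) := by
      rw [intervalIntegral.integral_const, hlen, Complex.real_smul]; push_cast; rfl
    rw [hc, ← intervalIntegral.integral_sub (by simp) (hψ.intervalIntegrable _ _)]
    have := intervalIntegral.norm_integral_le_of_norm_le_const (a := (k:ℝ)/n)
      (b := ((k+1:ℕ):ℝ)/n) (C := e/2) (f := fun u => ψ ((k:ℝ)/n) - ψ u) ?_
    · rwa [hlen, abs_of_pos (by positivity)] at this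
    · intro u hu
      have hle : (k:ℝ)/n ≤ ((k+1:ℕ):ℝ)/n := by
        rw [← sub_nonneg, hlen]; positivity
      rw [Set.uIoc_of_le hle] at hu
      have h1 : ((k+1:ℕ):ℝ)/n ≤ 1 := by
        rw [div_le_one hnpos]; push_cast; exact hk'
      have h0 : 0 ≤ (k:ℝ)/n := by positivity
      rw [← dist_eq_norm]
      refine (h _ ⟨h0, by linarith⟩ u ⟨by linarith [hu.1], by linarith [hu.2]⟩ ?_).le
      rw [Real.dist_eq, abs_sub_comm, abs_of_pos (by linarith [hu.1])]
      linarith [hu.2]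
  calc _ ≤ ∑ k ∈ Finset.range n, e/2 * (1/(n:ℝ)) := norm_sum_le_of_le _ hb
    _ = e/2 := by simp; field_simp
    _ < e := by linarith

open Filter Topology MeasureTheory in
theorem riemann_L (L : ℝ) (hL : 0 < L) (φ : ℝ → ℂ) (hφ : Continuous φ) :
    Tendsto (fun n : ℕ => ((L:ℂ) / (n:ℂ)) * ∑ k ∈ Finset.range n, φ (L * ((k:ℝ) / n) - L/2)) atTop
      (𝓝 (∫ v in (-L/2)..(L/2), φ v)) := by
  have h := (riemann_aux (fun u => φ (L * u - L/2)) (by fun_prop)).const_mul (L:ℂ)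
  have e : (L:ℂ) * ∫ u in (0:ℝ)..1, φ (L * u - L/2) = ∫ v in (-L/2)..(L/2), φ v := by
    rw [intervalIntegral.integral_comp_mul_sub _ hL.ne', Complex.real_smul, ← mul_assoc,
      ← Complex.ofReal_mul, mul_inv_cancel₀ hL.ne']
    rw [Complex.ofReal_one, one_mul]
    congr 1 <;> ring
  rw [e] at h
  refine h.congr fun n => ?_
  ring

open Filter Topology MeasureTheory in
theorem gauss_hat (t : ℝ) :
    ∫ v : ℝ, Complex.exp (-(v:ℂ)^2) * Complex.exp (-2*π*I*t*v)
      = ((√π * Real.exp (-(π^2*t^2)) : ℝ) : ℂ) := by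
  have h := fourierIntegral_gaussian (b := 1) (by simp) (-2*π*t)
  have : ∀ v : ℝ, Complex.exp (-(v:ℂ)^2) * Complex.exp (-2*π*I*t*v)
     = Complex.exp (I * (-2*π*t) * v) * Complex.exp (-1 * (v:ℂ)^2) := by
    intro v
    rw [mul_comm]; congr 2 <;> ring
  simp_rw [this]
  rw [h]
  have h2 : ((π:ℂ)/1)^(1/2:ℂ) = ((√π : ℝ):ℂ) := by
    rw [Real.sqrt_eq_rpow, Complex.ofReal_cpow pi_pos.le]; simp
  rw [h2]
  push_cast
  congr 2; ring

open Filter Topology MeasureTheory in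
theorem trunc_lim (t : ℝ) :
    Tendsto (fun L : ℝ => ∫ v in (-L/2)..(L/2), Complex.exp (-(v:ℂ)^2) * Complex.exp (-2*π*I*t*v))
      atTop (𝓝 ((√π * Real.exp (-(π^2*t^2)) : ℝ) : ℂ)) := by
  rw [← gauss_hat]
  apply intervalIntegral_tendsto_integral
  · have : Integrable (fun v : ℝ => Real.exp (-1 * v^2)) := integrable_exp_neg_mul_sq one_pos
    refine this.mono (by fun_prop) (ae_of_all _ fun v => ?_)
    rw [norm_mul, Complex.norm_exp, Complex.norm_exp]
    have h1 : (-(v:ℂ)^2).re = -1 * v^2 := by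
      rw [← Complex.ofReal_pow, ← Complex.ofReal_neg, Complex.ofReal_re]; ring
    have h2 : (-2*π*I*t*v : ℂ).re = 0 := by simp
    rw [h1, h2]; simp
  · exact (tendsto_neg_atTop_atBot.atBot_div_const (by norm_num : (0:ℝ) < 2))
  · exact tendsto_id.atTop_div_const (by norm_num)

theorem norm_phi (v t : ℝ) :
    ‖Complex.exp (-(v:ℂ)^2) * Complex.exp (-2*π*I*t*v)‖ = Real.exp (-1 * v^2) := by
  rw [norm_mul, Complex.norm_exp, Complex.norm_exp]
  have h1 : (-(v:ℂ)^2).re = -1 * v^2 := by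
    rw [← Complex.ofReal_pow, ← Complex.ofReal_neg, Complex.ofReal_re]; ring
  have h2 : (-2*π*I*t*v : ℂ).re = 0 := by simp
  rw [h1, h2]; simp

open Filter Topology MeasureTheory in
theorem exists_LB (c : ℝ) (hc : c < π * √π / 2) :
    ∃ L B : ℝ, 0 < L ∧ 0 < B ∧
      c < ∫ t in (-B)..B, ‖∫ v in (-L/2)..(L/2),
        Complex.exp (-(v:ℂ)^2) * Complex.exp (-2*π*I*t*v)‖^4 := by
  have hJ : ∫ t : ℝ, (√π * Real.exp (-(π^2*t^2)))^4 = π * √π / 2 := by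
    have : ∀ t : ℝ, (√π * Real.exp (-(π^2*t^2)))^4 = π^2 * Real.exp (-(4*π^2) * t^2) := by
      intro t
      rw [mul_pow, ← Real.exp_nat_mul]
      congr 1
      · rw [show (4:ℕ) = 2*2 from rfl, pow_mul, Real.sq_sqrt pi_pos.le]
      · congr 1; push_cast; ring
    simp_rw [this]
    rw [integral_const_mul, integral_gaussian, show π/(4*π^2) = π / (2*π)^2 by ring,
      Real.sqrt_div pi_pos.le, Real.sqrt_sq (by positivity)]
    field_simp
  have hint : Integrable (fun t : ℝ => (√π * Real.exp (-(π^2*t^2)))^4) := by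
    refine Integrable.of_integral_ne_zero ?_
    rw [hJ]; positivity
  have hB := intervalIntegral_tendsto_integral hint tendsto_neg_atTop_atBot
    (tendsto_id (α := ℝ) (x := atTop))
  rw [hJ] at hB
  obtain ⟨B, hBc, hB0⟩ := ((hB.eventually (lt_mem_nhds hc)).and (eventually_gt_atTop 0)).exists
  have hL : Tendsto (fun L : ℝ => ∫ t in (-B)..B, ‖∫ v in (-L/2)..(L/2),
        Complex.exp (-(v:ℂ)^2) * Complex.exp (-2*π*I*t*v)‖^4) atTop
        (𝓝 (∫ t in (-B)..B, (√π * Real.exp (-(π^2*t^2)))^4)) := by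
    apply intervalIntegral.tendsto_integral_filter_of_dominated_convergence (fun _ => √π^4)
    · refine Eventually.of_forall fun L => Continuous.aestronglyMeasurable ?_
      refine (Continuous.norm ?_).pow 4
      apply intervalIntegral.continuous_parametric_intervalIntegral_of_continuous'
      fun_prop
    · filter_upwards [eventually_gt_atTop 0] with L hL0
      refine ae_of_all _ fun t _ => ?_
      rw [norm_pow, norm_norm]
      gcongr
      have hle : -L/2 ≤ L/2 := by linarith
      calc _ ≤ ∫ v in (-L/2)..(L/2), Real.exp (-1 * v^2) := by
            refine (intervalIntegral.norm_integral_le_integral_norm hle).trans (le_of_eq ?_)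
            simp_rw [norm_phi]
        _ ≤ ∫ v : ℝ, Real.exp (-1 * v^2) := by
            rw [intervalIntegral.integral_of_le hle]
            exact setIntegral_le_integral (integrable_exp_neg_mul_sq one_pos)
              (ae_of_all _ fun v => (Real.exp_pos _).le)
        _ = √π := by rw [integral_gaussian]; simp
    · simp
    · refine ae_of_all _ fun t _ => ?_
      have := (trunc_lim t).norm.pow 4
      rwa [Complex.norm_real, Real.norm_of_nonneg (by positivity)] at this
  obtain ⟨L, hLc, hL0⟩ := ((hL.eventually (lt_mem_nhds hBc)).and (eventually_gt_atTop 0)).exists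
  exact ⟨L, B, hL0, hB0, hLc⟩

open Filter Topology MeasureTheory in
theorem J_lim (L B : ℝ) (hL : 0 < L) :
    Tendsto (fun n : ℕ => ∫ t in (-B)..B, ‖((L:ℂ) / (n:ℂ)) * ∑ k ∈ Finset.range n,
        (Complex.exp (-((L * ((k:ℝ) / n) - L/2 : ℝ):ℂ)^2)
          * Complex.exp (-2*π*I*t*((L * ((k:ℝ) / n) - L/2 : ℝ):ℂ)))‖^4) atTop
      (𝓝 (∫ t in (-B)..B, ‖∫ v in (-L/2)..(L/2),
        Complex.exp (-(v:ℂ)^2) * Complex.exp (-2*π*I*t*v)‖^4)) := by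
  apply intervalIntegral.tendsto_integral_filter_of_dominated_convergence (fun _ => L^4)
  · exact Eventually.of_forall fun n => Continuous.aestronglyMeasurable (by fun_prop)
  · filter_upwards [eventually_gt_atTop 0] with n hn
    have hn' : (0:ℝ) < n := by exact_mod_cast hn
    refine ae_of_all _ fun t _ => ?_
    rw [norm_pow, norm_norm]
    gcongr
    rw [norm_mul, norm_div, Complex.norm_real, Complex.norm_natCast, Real.norm_of_nonneg hL.le]
    have : ‖∑ k ∈ Finset.range n, (Complex.exp (-((L * ((k:ℝ) / n) - L/2 : ℝ):ℂ)^2)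
          * Complex.exp (-2*π*I*t*((L * ((k:ℝ) / n) - L/2 : ℝ):ℂ)))‖ ≤ ∑ k ∈ Finset.range n, (1:ℝ) := by
      refine norm_sum_le_of_le _ fun k _ => ?_
      rw [norm_phi, Real.exp_le_one_iff]
      nlinarith [sq_nonneg (L * ((k:ℝ) / n) - L/2)]
    simp only [Finset.sum_const, Finset.card_range, nsmul_eq_mul, mul_one] at this
    calc L / n * _ ≤ L / n * n := by gcongr
      _ = L := by field_simp
  · simp
  · refine ae_of_all _ fun t _ => ?_
    exact (riemann_L L hL (fun v => Complex.exp (-(v:ℂ)^2) * Complex.exp (-2*π*I*t*v))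
      (by fun_prop)).norm.pow 4

open Filter Topology MeasureTheory in
theorem T_lim (L : ℝ) (hL : 0 < L) : ∃ T : ℝ, 0 ≤ T ∧ T ≤ √(π / (4/3)) ∧
    Tendsto (fun n : ℕ => L / n * ∑ k ∈ Finset.range n,
      Real.exp (-(4/3) * (L * ((k:ℝ) / n) - L/2)^2)) atTop (𝓝 T) := by
  have hle : -L/2 ≤ L/2 := by linarith
  refine ⟨∫ v in (-L/2)..(L/2), Real.exp (-(4/3) * v^2), ?_, ?_, ?_⟩
  · exact intervalIntegral.integral_nonneg hle fun v _ => (Real.exp_pos _).le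
  · rw [← integral_gaussian, intervalIntegral.integral_of_le hle]
    exact setIntegral_le_integral (integrable_exp_neg_mul_sq (by norm_num))
              (ae_of_all _ fun v => (Real.exp_pos _).le)
  · have h := riemann_L L hL (fun v => ((Real.exp (-(4/3) * v^2) : ℝ) : ℂ)) (by fun_prop)
    rw [intervalIntegral.integral_ofReal] at h
    have h2 := (Complex.continuous_re.tendsto _).comp h
    rw [Complex.ofReal_re] at h2
    refine h2.congr fun n => ?_
    simp only [Function.comp]
    rw [← Complex.ofReal_natCast, ← Complex.ofReal_sum, ← Complex.ofReal_div,
      ← Complex.ofReal_mul, Complex.ofReal_re]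

theorem F_lower (L B : ℝ) (hL : 0 < L) (hB : 0 < B) (n : ℕ) (hn : 2 * B * L < n) :
    ((n:ℝ)/L)^3 * (∫ t in (-B)..B, ‖((L:ℂ) / (n:ℂ)) * ∑ k ∈ Finset.range n,
        (Complex.exp (-((L * ((k:ℝ) / n) - L/2 : ℝ):ℂ)^2)
          * Complex.exp (-2*π*I*t*((L * ((k:ℝ) / n) - L/2 : ℝ):ℂ)))‖^4)
    ≤ ∫ θ in (0:ℝ)..1, ‖∑ k ∈ Finset.range n,
        ((Real.exp (-(L * ((k:ℝ) / n) - L/2)^2) : ℝ) : ℂ) * Complex.exp (-2*π*I*k*θ)‖^4 := by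
  have hn' : (0:ℝ) < n := lt_trans (by positivity) hn
  set H : ℝ → ℝ := fun θ => ‖∑ k ∈ Finset.range n,
        ((Real.exp (-(L * ((k:ℝ) / n) - L/2)^2) : ℝ) : ℂ) * Complex.exp (-2*π*I*k*θ)‖^4 with hH
  have hHc : Continuous H := by rw [hH]; fun_prop
  have hper : Function.Periodic H 1 := by
    intro θ
    simp only [hH]
    congr 2
    refine Finset.sum_congr rfl fun k _ => ?_
    congr 1
    rw [Complex.exp_eq_exp_iff_exists_int]
    exact ⟨-k, by push_cast; ring⟩
  have h1 : ∫ θ in (0:ℝ)..1, H θ = ∫ θ in (-(1/2):ℝ)..(1/2), H θ := by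
    have := hper.intervalIntegral_add_eq 0 (-(1/2))
    norm_num at this ⊢
    exact this
  have key : ∀ t : ℝ, ‖((L:ℂ) / (n:ℂ)) * ∑ k ∈ Finset.range n,
        (Complex.exp (-((L * ((k:ℝ) / n) - L/2 : ℝ):ℂ)^2)
          * Complex.exp (-2*π*I*t*((L * ((k:ℝ) / n) - L/2 : ℝ):ℂ)))‖^4
        = (L/n)^4 * H ((L/n) * t) := by
    intro t
    have hs : ∑ k ∈ Finset.range n,
        (Complex.exp (-((L * ((k:ℝ) / n) - L/2 : ℝ):ℂ)^2)
          * Complex.exp (-2*π*I*t*((L * ((k:ℝ) / n) - L/2 : ℝ):ℂ)))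
        = Complex.exp ((π*t*L : ℝ) * I) * ∑ k ∈ Finset.range n,
        ((Real.exp (-(L * ((k:ℝ) / n) - L/2)^2) : ℝ) : ℂ)
          * Complex.exp (-2*π*I*k*((L/n*t : ℝ):ℂ)) := by
      rw [Finset.mul_sum]
      refine Finset.sum_congr rfl fun k _ => ?_
      rw [Complex.ofReal_exp, ← Complex.exp_add, ← Complex.exp_add, ← Complex.exp_add]
      congr 1
      push_cast
      ring
    rw [hs, norm_mul, norm_mul, Complex.norm_exp_ofReal_mul_I, one_mul, norm_div,
      Complex.norm_real, Complex.norm_natCast, Real.norm_of_nonneg hL.le, mul_pow]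
  simp_rw [key]
  rw [intervalIntegral.integral_const_mul,
    intervalIntegral.integral_comp_mul_left _ (by positivity : L/(n:ℝ) ≠ 0), smul_eq_mul]
  have e : ((n:ℝ)/L)^3 * ((L/n)^4 * ((L/n)⁻¹ * ∫ θ in (L/n * -B)..(L/n * B), H θ))
     = ∫ θ in (L/n * -B)..(L/n * B), H θ := by
    field_simp
  rw [e]
  change _ ≤ ∫ θ in (0:ℝ)..1, H θ
  rw [h1]
  have hb : L / n * B ≤ 1/2 := by
    rw [div_mul_eq_mul_div, div_le_iff₀ hn']; linarith
  have hb0 : 0 ≤ L / n * B := by positivity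
  apply intervalIntegral.integral_mono_interval (by linarith) (by linarith) hb
  · exact Filter.Eventually.of_forall fun θ => by simp only [hH]; positivity
  · exact hHc.intervalIntegrable _ _

theorem tsum_int_range {M : Type*} [AddCommMonoid M] [TopologicalSpace M] [T2Space M]
    (n : ℕ) (G : ℤ → M) (hG : ∀ x : ℤ, ¬ (0 ≤ x ∧ x < n) → G x = 0) :
    ∑' x : ℤ, G x = ∑ k ∈ Finset.range n, G k := by
  rw [tsum_eq_sum (s := (Finset.range n).map Nat.castEmbedding)]
  · simp
  · intro x hx
    apply hG
    rintro ⟨h0, h1⟩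
    apply hx
    simp only [Finset.mem_map, Finset.mem_range, Nat.castEmbedding_apply]
    exact ⟨x.toNat, by omega, by simp [h0]⟩

open Filter Topology in
/-- Lower bound construction: for large `n` there is `f : ℤ → ℝ` supported on an interval
of length `n` with `‖f̂‖₄ > ‖f‖_q`, where `q = 4/(3-(1+ε)log_n(3√3/4))`. -/
theorem stmt_16 (ε : ℝ) (hε : 0 < ε) :
    ∃ n₀ : ℕ, ∀ n : ℕ, n₀ ≤ n →
      ∃ (f : ℤ → ℝ) (a : ℤ),
        (∀ x : ℤ, f x ≠ 0 → a ≤ x ∧ x < a + n) ∧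
        (∑' x : ℤ, |f x| ^ (4 / (3 - (1 + ε) * Real.logb n (3 * Real.sqrt 3 / 4))))
            ^ (1 / (4 / (3 - (1 + ε) * Real.logb n (3 * Real.sqrt 3 / 4))))
          < (∫ θ in (0:ℝ)..1,
              ‖∑' x : ℤ, (f x : ℂ) * Complex.exp (-2 * π * I * x * θ)‖ ^ 4) ^ ((1:ℝ)/4) := by
  set K : ℝ := 3 * Real.sqrt 3 / 4 with hK
  have hs3 : √3 ^ 2 = 3 := Real.sq_sqrt (by norm_num)
  have hs30 : 0 < √(3:ℝ) := by positivity
  have hK1 : 1 < K := by rw [hK]; nlinarith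
  have hK0 : 0 < K := by linarith
  have hc : K ^ (-(1+ε)) * √(π / (4/3))^3 < π * √π / 2 := by
    have h1 : √(π / (4/3))^3 = K * (π * √π / 2) := by
      have : π / (4/3) = 3 * π / 2^2 := by ring
      rw [this, Real.sqrt_div (by positivity), Real.sqrt_sq (by norm_num),
        Real.sqrt_mul (by norm_num), hK]
      have hp : √π^2 = π := Real.sq_sqrt pi_pos.le
      calc (√3 * √π / 2)^3 = √3^2 * √3 * (√π^2 * √π) / 8 := by ring
        _ = _ := by rw [hs3, hp]; ring
    have h2 : K ^ (-(1+ε)) * K = K ^ (-ε) := by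
      conv_lhs => rw [← Real.rpow_add_one hK0.ne']
      congr 1; ring
    rw [h1, ← mul_assoc, h2]
    have h3 : K ^ (-ε) < 1 := Real.rpow_lt_one_of_one_lt_of_neg hK1 (by linarith)
    have : 0 < π * √π / 2 := by positivity
    nlinarith
  obtain ⟨L, B, hL, hB, hJ⟩ := exists_LB _ hc
  obtain ⟨T, hT0, hTc, hT⟩ := T_lim L hL
  have hJl := J_lim L B hL
  have hlog : Tendsto (fun n : ℕ => Real.logb n K) atTop (𝓝 0) := by
    simp only [Real.logb]
    exact (Real.tendsto_log_atTop.comp tendsto_natCast_atTop_atTop).const_div_atTop _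
  have hp : Tendsto (fun n : ℕ => 3 - (1+ε) * Real.logb n K) atTop (𝓝 3) := by
    simpa using (hlog.const_mul (1+ε)).const_sub 3
  have hTp := ((hT.div_const L).rpow hp (Or.inr (by norm_num))).const_mul (K ^ (-(1+ε)))
  have hlt : K ^ (-(1+ε)) * (T / L) ^ (3:ℝ) < (∫ t in (-B)..B, ‖∫ v in (-L/2)..(L/2),
        Complex.exp (-(v:ℂ)^2) * Complex.exp (-2*π*I*t*v)‖^4) / L^3 := by
    rw [lt_div_iff₀ (by positivity)]
    refine lt_of_le_of_lt ?_ hJ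
    rw [show (3:ℝ) = ((3:ℕ):ℝ) by norm_num, Real.rpow_natCast, div_pow, mul_assoc,
      div_mul_cancel₀ _ (by positivity)]
    push_cast
    gcongr
  have hev := hTp.eventually_lt (hJl.div_const (L^3)) hlt
  have hall := (hev.and (hp.eventually (lt_mem_nhds (by norm_num : (0:ℝ) < 3)))).and
    ((tendsto_natCast_atTop_atTop (R := ℝ)).eventually (eventually_gt_atTop (max 1 (2 * B * L))))
  obtain ⟨n₀, hn₀⟩ := eventually_atTop.mp hall
  refine ⟨n₀, fun n hn => ?_⟩
  obtain ⟨⟨h1, hp0⟩, hnb⟩ := hn₀ n hn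
  have hn1 : (1:ℝ) < n := lt_of_le_of_lt (le_max_left _ _) hnb
  have hn2 : 2 * B * L < n := lt_of_le_of_lt (le_max_right _ _) hnb
  have hlow := F_lower L B hL hB n hn2
  have hlogpos : 0 < Real.logb n K := Real.logb_pos hn1 hK1
  have hnp : (n:ℝ) ^ (3 - (1+ε) * Real.logb n K) = n^3 * K ^ (-(1+ε)) := by
    rw [sub_eq_add_neg, Real.rpow_add (by linarith)]
    congr 1
    · exact_mod_cast Real.rpow_natCast (n:ℝ) 3
    · rw [show -((1+ε) * Real.logb n K) = Real.logb n K * (-(1+ε)) by ring,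
        Real.rpow_mul (by linarith), Real.rpow_logb (by linarith) hn1.ne' hK0]
  set p : ℝ := 3 - (1+ε) * Real.logb n K with hpdef
  have hp3 : p ≤ 3 := by rw [hpdef]; nlinarith
  have hq : 4/3 ≤ 4 / p := by gcongr
  refine ⟨fun x => if 0 ≤ x ∧ x < n then Real.exp (-(L * ((x:ℝ) / n) - L/2)^2) else 0, 0, ?_, ?_⟩
  · intro x hx
    by_contra h
    rw [zero_add] at h
    simp [h] at hx
  have hA : ∀ θ : ℝ, ∑' x : ℤ, (((if 0 ≤ x ∧ x < n then Real.exp (-(L * ((x:ℝ) / n) - L/2)^2)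
      else 0 : ℝ)) : ℂ) * Complex.exp (-2 * π * I * x * θ) = ∑ k ∈ Finset.range n,
        ((Real.exp (-(L * ((k:ℝ) / n) - L/2)^2) : ℝ) : ℂ) * Complex.exp (-2*π*I*k*θ) := by
    intro θ
    rw [tsum_int_range n _ (fun x hx => by simp [hx])]
    refine Finset.sum_congr rfl fun k hk => ?_
    rw [if_pos ⟨by positivity, by exact_mod_cast Finset.mem_range.mp hk⟩]
    simp only [Int.cast_natCast]
  have hS : ∑' x : ℤ, |if 0 ≤ x ∧ x < n then Real.exp (-(L * ((x:ℝ) / n) - L/2)^2)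
      else 0| ^ (4/p) ≤ n * ((L / n * ∑ k ∈ Finset.range n,
      Real.exp (-(4/3) * (L * ((k:ℝ) / n) - L/2)^2)) / L) := by
    have e : n * ((L / n * ∑ k ∈ Finset.range n,
      Real.exp (-(4/3) * (L * ((k:ℝ) / n) - L/2)^2)) / L) = ∑ k ∈ Finset.range n,
      Real.exp (-(4/3) * (L * ((k:ℝ) / n) - L/2)^2) := by
      have : (n:ℝ) ≠ 0 := by linarith
      generalize ∑ k ∈ Finset.range n, Real.exp (-(4/3) * (L * ((k:ℝ) / n) - L/2)^2) = S
      field_simp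
    rw [e, tsum_int_range n _ (fun x hx => by
      rw [if_neg hx, abs_zero, Real.zero_rpow (by positivity)])]
    refine Finset.sum_le_sum fun k hk => ?_
    rw [if_pos ⟨by positivity, by exact_mod_cast Finset.mem_range.mp hk⟩, abs_of_pos
      (Real.exp_pos _), ← Real.exp_mul, Real.exp_le_exp]
    simp only [Int.cast_natCast]
    nlinarith [sq_nonneg (L * ((k:ℝ) / n) - L/2)]
  simp_rw [hA]
  have hX0 : 0 ≤ ∑' x : ℤ, |if 0 ≤ x ∧ x < n then Real.exp (-(L * ((x:ℝ) / n) - L/2)^2)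
      else 0| ^ (4/p) := tsum_nonneg fun x => by positivity
  rw [show 1 / (4 / p) = p * (1/4) by field_simp, Real.rpow_mul hX0]
  refine Real.rpow_lt_rpow (by positivity) ?_ (by norm_num)
  refine lt_of_lt_of_le ?_ hlow
  refine (Real.rpow_le_rpow hX0 hS hp0.le).trans_lt ?_
  rw [Real.mul_rpow (by linarith) (by positivity), hnp, mul_assoc]
  have hn3 : (0:ℝ) < (n:ℝ)^3 := by positivity
  refine (mul_lt_mul_of_pos_left h1 hn3).trans_le (le_of_eq ?_)
  rw [div_pow, div_mul_eq_mul_div, mul_div_assoc]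
end
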